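/- Suppose (A1)-(A3) hold and all coordinates of the mean vector M are strictly positive. Then: (i) the function h(x) = P_x(τ = ∞) is strictly positive and harmonic for the Markov chain (Z(t)); (ii) every sequence x_n ∈ ℤ_+^d with |x_n| → ∞ and x_n/|x_n| → M/|M| is fundamental for (Z(t)), and for every x ∈ ℤ_+^d, lim_n G(x,x_n)/G(x_0,x_n) = P_x(τ = ∞)/P_{x_0}(τ = ∞). -/

import Mathlib

open Filter Topology

attribute [local instance] Classical.propDecidable

noncomputable section

variable {V : Type*} [AddCommGroup V]

/-- `n`-step transition kernel of the random walk with step distribution `μ`,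
killed upon leaving the set `A` : `kern μ A n x y = P_x(S n = y, τ_A > n)`,
where `τ_A` is the first exit time from `A`. -/
def kern (μ : V → ℝ) (A : Set V) : ℕ → V → V → ℝ
  | 0 => fun x y => if x = y ∧ x ∈ A then 1 else 0
  | n + 1 => fun x y => ∑' z : V, (if x ∈ A then μ (z - x) else 0) * kern μ A n z y

/-- Green function of the walk killed outside `A`. -/
def green (μ : V → ℝ) (A : Set V) (x y : V) : ℝ :=
  ∑' n : ℕ, kern μ A n x y

/-- `E_x [ g(S τ) ; S τ ∈ B, τ < ∞ ]`, where `τ` is the first exit time from `A`. -/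
def exitExp (μ : V → ℝ) (A B : Set V) (g : V → ℝ) (x : V) : ℝ :=
  ∑' n : ℕ, ∑' z : V, kern μ A n x z *
    ∑' y : V, (if y ∉ A ∧ y ∈ B then μ (y - z) else 0) * g y

/-- `ℝ≥0∞`-valued version of `exitExp`. -/
def exitExpE (μ : V → ℝ) (A B : Set V) (g : V → ℝ) (x : V) : ENNReal :=
  ∑' n : ℕ, ∑' z : V, ENNReal.ofReal (kern μ A n x z) *
    ∑' y : V, ENNReal.ofReal ((if y ∉ A ∧ y ∈ B then μ (y - z) else 0) * g y)

/-- `P_x(S t = y for some t ≥ 0)` for the walk killed outside `A`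
(first passage decomposition). -/
def hitProb (μ : V → ℝ) (A : Set V) (x y : V) : ℝ :=
  (if x = y ∧ x ∈ A then 1 else 0) +
    ∑' n : ℕ, ∑' z : V, kern μ (A \ {y}) n x z * (if y ∈ A then μ (y - z) else 0)

/-- `h` is (strictly speaking, satisfies the mean value property of a) harmonic
function on `A` for the walk with step distribution `μ` killed outside `A`. -/
def HarmOn (μ : V → ℝ) (A : Set V) (h : V → ℝ) : Prop :=
  ∀ x ∈ A, h x = ∑' y : V, if y ∈ A then μ (y - x) * h y else 0

/-- Irreducibility of the walk killed outside `A`. -/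
def Irred (μ : V → ℝ) (A : Set V) : Prop :=
  ∀ x ∈ A, ∀ x' ∈ A, ∃ (k : ℕ) (c : ℕ → V), c 0 = x ∧ c k = x' ∧
    (∀ j ≤ k, c j ∈ A) ∧ ∀ j < k, 0 < μ (c (j + 1) - c j)

/-- A sequence `xs` is fundamental for the walk killed outside `A` :
the Martin kernels `G(x, xs n)/G(x₀, xs n)` converge for every `x ∈ A`. -/
def Fundamental (μ : V → ℝ) (A : Set V) (x₀ : V) (xs : ℕ → V) : Prop :=
  ∀ x ∈ A, ∃ L : ℝ,
    Tendsto (fun n => green μ A x (xs n) / green μ A x₀ (xs n)) atTop (𝓝 L)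

/-- ℓ¹-norm of an integer vector. -/
def znorm {ι : Type*} [Fintype ι] (x : ι → ℤ) : ℝ := ∑ i, |(x i : ℝ)|

/-- ℓ¹-norm of a real vector. -/
def rnorm {ι : Type*} [Fintype ι] (q : ι → ℝ) : ℝ := ∑ i, |q i|

variable {d : ℕ}

/-- `ℤ^{Λ,d}_+ = {x ∈ ℤ^d : xⁱ > 0 for all i ∈ Λ}`. -/
def posDom (Λ : Set (Fin d)) : Set (Fin d → ℤ) := {x | ∀ i ∈ Λ, 0 < x i}

/-- `ℤ^d_+ = {x ∈ ℤ^d : xⁱ > 0 for all i}`. -/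
def posAll : Set (Fin d → ℤ) := {x | ∀ i, 0 < x i}

/-- `a · z` for `a ∈ ℝ^d`, `z ∈ ℤ^d`. -/
def dotZ (a : Fin d → ℝ) (z : Fin d → ℤ) : ℝ := ∑ i, a i * (z i : ℝ)

/-- `a · q` for `a, q ∈ ℝ^d`. -/
def dotR (a q : Fin d → ℝ) : ℝ := ∑ i, a i * q i

/-- jump generating function `φ(a) = Σ_z μ(z) exp(a·z)` (valued in `ℝ≥0∞`). -/
def phiE (μ : (Fin d → ℤ) → ℝ) (a : Fin d → ℝ) : ENNReal :=
  ∑' z : Fin d → ℤ, ENNReal.ofReal (μ z * Real.exp (dotZ a z))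

/-- `D = {a ∈ ℝ^d : φ(a) ≤ 1}`. -/
def Dset (μ : (Fin d → ℤ) → ℝ) : Set (Fin d → ℝ) := {a | phiE μ a ≤ 1}

/-- mean vector `M = Σ_z μ(z) z`. -/
def Mvec (μ : (Fin d → ℤ) → ℝ) : Fin d → ℝ := fun i => ∑' z : Fin d → ℤ, μ z * (z i : ℝ)

/-- `Λ(M) = {i : Mⁱ = 0}`. -/
def LambdaM (μ : (Fin d → ℤ) → ℝ) : Set (Fin d) := {i | Mvec μ i = 0}

/-- Assumption (A1) : irreducibility on every `ℤ^{Λ,d}_+`. -/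
def A1 (μ : (Fin d → ℤ) → ℝ) : Prop := ∀ Λ : Set (Fin d), Irred μ (posDom Λ)

/-- Assumption (A2) : `φ` is finite on a neighborhood of the set `D`. -/
def A2 (μ : (Fin d → ℤ) → ℝ) : Prop :=
  ∃ U : Set (Fin d → ℝ), IsOpen U ∧ Dset μ ⊆ U ∧ ∀ a ∈ U, phiE μ a ≠ ⊤

/-- Assumption (A3) : `M ≠ 0`. -/
def A3 (μ : (Fin d → ℤ) → ℝ) : Prop := Mvec μ ≠ 0

/-- projection `x ↦ x^Λ`. -/
def projL (Λ : Set (Fin d)) (x : Fin d → ℤ) : ↥Λ → ℤ := fun i => x (i : Fin d)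

/-- jump distribution `μ_Λ(v) = Σ_{x : x^Λ = v} μ(x)` of the projected walk. -/
def muL (μ : (Fin d → ℤ) → ℝ) (Λ : Set (Fin d)) (v : ↥Λ → ℤ) : ℝ :=
  ∑' x : Fin d → ℤ, if projL Λ x = v then μ x else 0

/-- `ℤ^Λ_+`. -/
def posL (Λ : Set (Fin d)) : Set (↥Λ → ℤ) := {u | ∀ i, 0 < u i}

end

/-- `P_x(τ = ∞) = 1 − P_x(τ < ∞)`, where `τ` is the first exit time from `ℤ^d_+`. -/
noncomputable def survP {d : ℕ} (μ : (Fin d → ℤ) → ℝ) (x : Fin d → ℤ) : ℝ :=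
  1 - exitExp μ posAll Set.univ (fun _ => 1) x

section ConvolutionPowers

open scoped ENNReal

variable {V : Type*} [AddCommGroup V]

/-- `n`-fold convolution power of a weight `m` on `V`. -/
noncomputable def convPow (m : V → ℝ≥0∞) : ℕ → V → ℝ≥0∞
  | 0 => fun y => if y = 0 then 1 else 0
  | n + 1 => fun y => ∑' z, m z * convPow m n (y - z)

/-- Potential kernel `∑ₙ m^{*n}` of a weight `m`. -/
noncomputable def potential (m : V → ℝ≥0∞) (y : V) : ℝ≥0∞ := ∑' n, convPow m n y

lemma tsum_sub_const (f : V → ℝ≥0∞) (z : V) : ∑' y, f (y - z) = ∑' y, f y :=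
  (Equiv.subRight z).tsum_eq f

lemma tsum_convPow_succ_mul (m : V → ℝ≥0∞) (n : ℕ) (W : V → ℝ≥0∞) :
    ∑' z, convPow m (n + 1) z * W z = ∑' v, m v * ∑' u, convPow m n u * W (u + v) := by
  simp only [convPow, ← ENNReal.tsum_mul_right]
  rw [ENNReal.tsum_comm]
  refine tsum_congr fun v => ?_
  rw [← ENNReal.tsum_mul_left,
    ← tsum_sub_const (fun u => m v * (convPow m n u * W (u + v))) v]
  refine tsum_congr fun z => ?_
  rw [sub_add_cancel, mul_assoc]

lemma tsum_convPow_zero_mul (m : V → ℝ≥0∞) (W : V → ℝ≥0∞) :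
    ∑' z, convPow m 0 z * W z = W 0 := by
  simp [convPow, ite_mul]

lemma tsum_convPow (m : V → ℝ≥0∞) (n : ℕ) : ∑' z, convPow m n z = (∑' z, m z) ^ n := by
  induction n with
  | zero => simpa using tsum_convPow_zero_mul m fun _ => 1
  | succ n ih =>
    have h := tsum_convPow_succ_mul m n fun _ => 1
    simp only [mul_one] at h
    rw [h, ih, ENNReal.tsum_mul_right, pow_succ']

/-- Chernoff bound for convolution powers, with a submultiplicative weight. -/
lemma tsum_convPow_mul_le (m W : V → ℝ≥0∞) (h0 : W 0 ≤ 1) (hW : ∀ x y, W (x + y) ≤ W x * W y)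
    (n : ℕ) : ∑' z, convPow m n z * W z ≤ (∑' z, m z * W z) ^ n := by
  induction n with
  | zero => simpa [tsum_convPow_zero_mul] using h0
  | succ n ih =>
    rw [tsum_convPow_succ_mul, pow_succ', ← ENNReal.tsum_mul_right]
    refine ENNReal.tsum_le_tsum fun v => ?_
    rw [mul_assoc]
    gcongr
    refine le_trans ?_ (mul_le_mul_right ih _)
    rw [← ENNReal.tsum_mul_left]
    refine ENNReal.tsum_le_tsum fun u => ?_
    calc convPow m n u * W (u + v) ≤ convPow m n u * (W u * W v) := by gcongr; exact hW u v
      _ = W v * (convPow m n u * W u) := by ring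

lemma tsum_potential_mul_le (m W : V → ℝ≥0∞) (h0 : W 0 ≤ 1)
    (hW : ∀ x y, W (x + y) ≤ W x * W y) :
    ∑' z, potential m z * W z ≤ (1 - ∑' z, m z * W z)⁻¹ := by
  rw [← ENNReal.tsum_geometric]
  simp only [potential, ← ENNReal.tsum_mul_right]
  rw [ENNReal.tsum_comm]
  exact ENNReal.tsum_le_tsum fun n => tsum_convPow_mul_le m W h0 hW n

lemma potential_eq (m : V → ℝ≥0∞) (y : V) :
    potential m y = (if y = 0 then 1 else 0) + ∑' z, m z * potential m (y - z) := by
  rw [potential, tsum_eq_zero_add' ENNReal.summable]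
  simp only [convPow, potential, ← ENNReal.tsum_mul_left]
  rw [ENNReal.tsum_comm]

lemma one_le_potential_zero (m : V → ℝ≥0∞) : 1 ≤ potential m 0 := by
  rw [potential_eq]; simp

lemma mul_potential_le (m : V → ℝ≥0∞) (s y : V) : m s * potential m (y - s) ≤ potential m y := by
  rw [potential_eq m y]
  exact (ENNReal.le_tsum (f := fun z => m z * potential m (y - z)) s).trans le_add_self

lemma tsum_convPow_mul_potential_le (m : V → ℝ≥0∞) (n : ℕ) (y : V) :
    ∑' z, convPow m n z * potential m (y - z) ≤ potential m y := by
  induction n generalizing y with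
  | zero => rw [tsum_convPow_zero_mul m fun z => potential m (y - z), sub_zero]
  | succ n ih =>
    rw [tsum_convPow_succ_mul m n fun z => potential m (y - z), potential_eq m y]
    refine le_trans (ENNReal.tsum_le_tsum fun v => ?_) le_add_self
    gcongr
    simpa only [add_comm _ v, sub_add_eq_sub_sub] using ih (y - v)

lemma convPow_const_mul (a : ℝ≥0∞) (m : V → ℝ≥0∞) (n : ℕ) (y : V) :
    convPow (fun z => a * m z) n y = a ^ n * convPow m n y := by
  induction n generalizing y with
  | zero => simp [convPow]
  | succ n ih =>
    simp only [convPow, ih, ← ENNReal.tsum_mul_left]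
    exact tsum_congr fun z => by ring

/-- `stepCount q ν s n k y` is the weight of the `n`-step paths from `0` to `y` that make exactly
`k` marked steps `s` (of weight `q`), the other steps being weighted by `ν`. -/
noncomputable def stepCount (q : ℝ≥0∞) (ν : V → ℝ≥0∞) (s : V) : ℕ → ℕ → V → ℝ≥0∞
  | 0, 0 => fun y => if y = 0 then 1 else 0
  | 0, _ + 1 => fun _ => 0
  | n + 1, 0 => fun y => ∑' z, ν z * stepCount q ν s n 0 (y - z)
  | n + 1, k + 1 => fun y =>
      q * stepCount q ν s n k (y - s) + ∑' z, ν z * stepCount q ν s n (k + 1) (y - z)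

/-- Exchangeability of the steps: weighting by the number of marked steps amounts to choosing
which step is marked. -/
lemma succ_mul_stepCount (q : ℝ≥0∞) (ν : V → ℝ≥0∞) (s : V) (n k : ℕ) (y : V) :
    ((k : ℝ≥0∞) + 1) * stepCount q ν s (n + 1) (k + 1) y
      = ((n : ℝ≥0∞) + 1) * (q * stepCount q ν s n k (y - s)) := by
  induction n generalizing k y with
  | zero => cases k <;> simp [stepCount]
  | succ n ih =>
    have hsum : ((k : ℝ≥0∞) + 1) * ∑' z, ν z * stepCount q ν s (n + 1) (k + 1) (y - z)
        = (n + 1) * (q * ∑' z, ν z * stepCount q ν s n k (y - s - z)) := by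
      simp only [← ENNReal.tsum_mul_left]
      refine tsum_congr fun z => ?_
      rw [mul_left_comm, ih, sub_right_comm]
      ring
    have key : (k : ℝ≥0∞) * stepCount q ν s (n + 1) k (y - s)
        + (n + 1) * ∑' z, ν z * stepCount q ν s n k (y - s - z)
        = (n + 1) * stepCount q ν s (n + 1) k (y - s) := by
      cases k with
      | zero => simp [stepCount]
      | succ k =>
        push_cast
        rw [ih]
        simp only [stepCount]
        ring
    rw [stepCount, mul_add, hsum]
    calc _ = q * ((k : ℝ≥0∞) * stepCount q ν s (n + 1) k (y - s)
        + (n + 1) * ∑' z, ν z * stepCount q ν s n k (y - s - z))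
        + q * stepCount q ν s (n + 1) k (y - s) := by ring
      _ = _ := by rw [key]; push_cast; ring

lemma tsum_stepCount_mul_pow (q r : ℝ≥0∞) (ν : V → ℝ≥0∞) (s : V) (hν : ν s = 0) (n : ℕ) (y : V) :
    ∑' k, stepCount q ν s n k y * r ^ k
      = convPow (fun z => if z = s then r * q else ν z) n y := by
  induction n generalizing y with
  | zero =>
    rw [tsum_eq_zero_add' ENNReal.summable]
    simp [stepCount, convPow]
  | succ n ih =>
    have h1 : ∀ f : V → ℝ≥0∞, ∑' z, (if z = s then r * q else ν z) * f z
        = r * q * f s + ∑' z, ν z * f z := by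
      intro f
      rw [← tsum_ite_eq s fun z => r * q * f z, ← ENNReal.tsum_add]
      refine tsum_congr fun z => ?_
      split_ifs with h
      · simp [h, hν]
      · simp
    have h2 : ∑' z, ν z * ∑' k, stepCount q ν s n k (y - z) * r ^ k
        = ∑' z, ν z * stepCount q ν s n 0 (y - z)
          + ∑' k : ℕ, (∑' z, ν z * stepCount q ν s n (k + 1) (y - z)) * r ^ (k + 1) := by
      simp only [← ENNReal.tsum_mul_left, ← ENNReal.tsum_mul_right]
      rw [ENNReal.tsum_comm, tsum_eq_zero_add' ENNReal.summable]
      simp [mul_assoc]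
    rw [tsum_eq_zero_add' ENNReal.summable]
    simp only [convPow]
    rw [h1 fun z => convPow (fun z => if z = s then r * q else ν z) n (y - z)]
    simp only [← ih, stepCount, add_mul]
    rw [ENNReal.tsum_add, h2, ← ENNReal.tsum_mul_left]
    have h3 : ∀ k, q * stepCount q ν s n k (y - s) * r ^ (k + 1)
        = r * q * (stepCount q ν s n k (y - s) * r ^ k) := fun k => by ring
    simp only [h3, pow_zero, mul_one]
    ring

/-- Comparison of the potential at `y - s` and at `y`, up to the potential of an exponentially
tilted weight. -/
lemma mul_potential_sub_le (m : V → ℝ≥0∞) (s y : V) {θ c : ℝ} (hθ : 0 ≤ θ) (hc : 0 ≤ c) :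
    ENNReal.ofReal θ * (m s * potential m (y - s)) ≤ ENNReal.ofReal (θ * c) * potential m y
      + potential (fun z => m z * ENNReal.ofReal
        (Real.exp (θ * ((if z = s then 1 else 0) - c)))) y := by
  set ν : V → ℝ≥0∞ := fun z => if z = s then 0 else m z with hνdef
  have hν : ν s = 0 := by simp [hνdef]
  set r := ENNReal.ofReal (Real.exp θ)
  set a := ENNReal.ofReal (Real.exp (-(θ * c)))
  set l : V → ℝ≥0∞ :=
    fun z => m z * ENNReal.ofReal (Real.exp (θ * ((if z = s then 1 else 0) - c))) with hl
  have hm : (fun z => if z = s then 1 * m s else ν z) = m := by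
    ext z; by_cases h : z = s <;> simp [hνdef, h]
  have hlr : (fun z => a * (if z = s then r * m s else ν z)) = l := by
    ext z
    by_cases h : z = s
    · simp only [h, hl, if_true, r, a]
      rw [← mul_assoc, ← ENNReal.ofReal_mul (Real.exp_pos _).le, ← Real.exp_add, mul_comm]
      congr 3; ring
    · simp only [h, hl, hνdef, if_false, a]
      rw [mul_comm]; congr 3; ring
  have hJ1 : ∀ n y, ∑' k, stepCount (m s) ν s n k y = convPow m n y := by
    intro n y
    have := tsum_stepCount_mul_pow (m s) 1 ν s hν n y
    simpa only [one_pow, mul_one, hm] using this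
  have hJr : ∀ n y, ∑' k, stepCount (m s) ν s n k y * (r ^ k * a ^ n) = convPow l n y := by
    intro n y
    rw [← hlr, convPow_const_mul, ← tsum_stepCount_mul_pow (m s) r ν s hν n y,
      ← ENNReal.tsum_mul_left]
    exact tsum_congr fun k => by ring
  have hexp : ∀ n k : ℕ, ENNReal.ofReal θ * k ≤ ENNReal.ofReal (θ * c) * n + r ^ k * a ^ n := by
    intro n k
    simp only [r, a]
    rw [← ENNReal.ofReal_pow (Real.exp_pos _).le, ← ENNReal.ofReal_pow (Real.exp_pos _).le,
      ← Real.exp_nat_mul, ← Real.exp_nat_mul, ← ENNReal.ofReal_mul (Real.exp_pos _).le,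
      ← Real.exp_add, ← ENNReal.ofReal_natCast k, ← ENNReal.ofReal_natCast n,
      ← ENNReal.ofReal_mul hθ, ← ENNReal.ofReal_mul (by positivity),
      ← ENNReal.ofReal_add (by positivity) (Real.exp_pos _).le]
    refine ENNReal.ofReal_le_ofReal ?_
    have := Real.add_one_le_exp ((k : ℝ) * θ + n * -(θ * c))
    linarith
  have hstep : ∀ n, ENNReal.ofReal θ * (m s * convPow m n (y - s))
      ≤ ENNReal.ofReal (θ * c) * convPow m (n + 1) y + convPow l (n + 1) y := by
    intro n
    have h1 : ENNReal.ofReal θ * ((n + 1) * (m s * convPow m n (y - s)))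
        = ∑' k : ℕ, ENNReal.ofReal θ * k * stepCount (m s) ν s (n + 1) k y := by
      rw [tsum_eq_zero_add' ENNReal.summable, ← hJ1]
      simp only [Nat.cast_zero, mul_zero, zero_mul, zero_add, ← ENNReal.tsum_mul_left]
      refine tsum_congr fun k => ?_
      rw [← succ_mul_stepCount]
      push_cast; ring
    have h2 : ∑' k : ℕ, ENNReal.ofReal θ * k * stepCount (m s) ν s (n + 1) k y
        ≤ ENNReal.ofReal (θ * c) * (n + 1 : ℕ) * convPow m (n + 1) y + convPow l (n + 1) y := by
      rw [← hJ1, ← hJr, ← ENNReal.tsum_mul_left, ← ENNReal.tsum_add]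
      refine ENNReal.tsum_le_tsum fun k => ?_
      rw [mul_comm _ (r ^ k * _), ← add_mul]
      gcongr
      exact hexp _ _
    have hn : ((n : ℝ≥0∞) + 1) ≠ 0 := by simp
    have hn' : ((n : ℝ≥0∞) + 1) ≠ ⊤ := by simp
    rw [← ENNReal.mul_le_mul_iff_right hn hn']
    calc _ = ENNReal.ofReal θ * ((n + 1) * (m s * convPow m n (y - s))) := by ring
      _ ≤ _ := h1.trans_le h2
      _ ≤ ENNReal.ofReal (θ * c) * (n + 1 : ℕ) * convPow m (n + 1) y
          + (n + 1) * convPow l (n + 1) y := by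
        gcongr
        exact le_mul_of_one_le_left' (by simp)
      _ = _ := by push_cast; ring
  have hsucc : ∀ m' : V → ℝ≥0∞, ∑' n, convPow m' (n + 1) y ≤ potential m' y := fun m' => by
    rw [potential, tsum_eq_zero_add' (f := fun n => convPow m' n y) ENNReal.summable]
    exact le_add_self
  calc _ = ∑' n, ENNReal.ofReal θ * (m s * convPow m n (y - s)) := by
        simp only [potential, ENNReal.tsum_mul_left]
    _ ≤ ∑' n, (ENNReal.ofReal (θ * c) * convPow m (n + 1) y + convPow l (n + 1) y) :=
        ENNReal.tsum_le_tsum hstep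
    _ ≤ _ := by
        rw [ENNReal.tsum_add, ENNReal.tsum_mul_left]
        gcongr
        · exact hsucc m
        · exact hsucc l

end ConvolutionPowers

section KilledWalk

open scoped ENNReal

variable {V : Type*} [AddCommGroup V]

/-- `ℝ≥0∞`-valued version of `kern`. -/
noncomputable def killedKern (m : V → ℝ≥0∞) (A : Set V) : ℕ → V → V → ℝ≥0∞
  | 0 => fun x y => if x = y ∧ x ∈ A then 1 else 0
  | n + 1 => fun x y => ∑' z, (if x ∈ A then m (z - x) else 0) * killedKern m A n z y

/-- `exitKern m A n x z` is the weight of the paths from `x` that leave `A` for the first time at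
step `n + 1`, at the point `z`. -/
noncomputable def exitKern (m : V → ℝ≥0∞) (A : Set V) : ℕ → V → V → ℝ≥0∞
  | 0 => fun x z => if x ∈ A ∧ z ∉ A then m (z - x) else 0
  | n + 1 => fun x z => ∑' v, (if x ∈ A then m (v - x) else 0) * exitKern m A n v z

/-- Exit distribution of the walk started at `x` and killed outside `A`. -/
noncomputable def exitLaw (m : V → ℝ≥0∞) (A : Set V) (x z : V) : ℝ≥0∞ := ∑' n, exitKern m A n x z

lemma killedKern_of_notMem (m : V → ℝ≥0∞) {A : Set V} {x : V} (hx : x ∉ A) (n : ℕ) (y : V) :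
    killedKern m A n x y = 0 := by
  cases n <;> simp [killedKern, hx]

lemma exitKern_of_notMem (m : V → ℝ≥0∞) {A : Set V} {x : V} (hx : x ∉ A) (n : ℕ) (y : V) :
    exitKern m A n x y = 0 := by
  cases n <;> simp [exitKern, hx]

lemma exitKern_of_mem (m : V → ℝ≥0∞) {A : Set V} {y : V} (hy : y ∈ A) (n : ℕ) (x : V) :
    exitKern m A n x y = 0 := by
  induction n generalizing x with
  | zero => simp [exitKern, hy]
  | succ n ih => simp [exitKern, ih]

lemma exitLaw_of_mem (m : V → ℝ≥0∞) {A : Set V} {y : V} (hy : y ∈ A) (x : V) :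
    exitLaw m A x y = 0 := by
  simp [exitLaw, exitKern_of_mem m hy]

lemma tsum_killedKern_mul (m : V → ℝ≥0∞) (A : Set V) (n : ℕ) (x z : V) :
    ∑' w, killedKern m A n x w * (if z ∉ A then m (z - w) else 0) = exitKern m A n x z := by
  induction n generalizing x with
  | zero =>
    rw [tsum_eq_single x]
    · by_cases hx : x ∈ A <;> simp [killedKern, exitKern, hx]
    · intro w hw
      simp [killedKern, hw.symm]
  | succ n ih =>
    simp only [killedKern, exitKern, ← ih, ← ENNReal.tsum_mul_left, ← ENNReal.tsum_mul_right]
    rw [ENNReal.tsum_comm]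
    exact tsum_congr fun v => tsum_congr fun w => by ring

/-- First exit decomposition of the transition probabilities. -/
lemma convPow_sub_eq (m : V → ℝ≥0∞) {A : Set V} (n : ℕ) {x : V} (hx : x ∈ A) (y : V) :
    convPow m n (y - x) = killedKern m A n x y
      + ∑ k ∈ Finset.range n, ∑' z, exitKern m A k x z * convPow m (n - 1 - k) (y - z) := by
  induction n generalizing x with
  | zero => simp [convPow, killedKern, hx, sub_eq_zero, eq_comm]
  | succ n ih =>
    have ih' : ∀ v, convPow m n (y - v) = killedKern m A n v y
        + (∑ k ∈ Finset.range n, ∑' z, exitKern m A k v z * convPow m (n - 1 - k) (y - z))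
        + (if v ∉ A then convPow m n (y - v) else 0) := by
      intro v
      by_cases hv : v ∈ A
      · simp only [hv, not_true_eq_false, if_false, add_zero]
        exact ih hv
      · simp [hv, killedKern_of_notMem, exitKern_of_notMem]
    have h1 : convPow m (n + 1) (y - x) = ∑' v, m (v - x) * convPow m n (y - v) := by
      simp only [convPow]
      rw [← tsum_sub_const (fun z => m z * convPow m n (y - x - z)) x]
      exact tsum_congr fun v => by rw [sub_sub_sub_cancel_right]
    have h2 : ∀ k, k ∈ Finset.range n →
        ∑' v, m (v - x) * ∑' z, exitKern m A k v z * convPow m (n - 1 - k) (y - z)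
        = ∑' z, exitKern m A (k + 1) x z * convPow m (n - (k + 1)) (y - z) := by
      intro k _
      simp only [exitKern, hx, if_true, ← ENNReal.tsum_mul_left, ← ENNReal.tsum_mul_right]
      rw [ENNReal.tsum_comm]
      have : n - 1 - k = n - (k + 1) := by omega
      rw [this]
      exact tsum_congr fun v => tsum_congr fun w => by ring
    have h3 : ∑' v, m (v - x) * (if v ∉ A then convPow m n (y - v) else 0)
        = ∑' z, exitKern m A 0 x z * convPow m n (y - z) := by
      refine tsum_congr fun v => ?_
      by_cases hv : v ∈ A <;> simp [exitKern, hv, hx]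
    rw [h1, Finset.sum_range_succ']
    calc _ = ∑' v, (m (v - x) * killedKern m A n v y
          + (∑ k ∈ Finset.range n,
              m (v - x) * ∑' z, exitKern m A k v z * convPow m (n - 1 - k) (y - z))
          + m (v - x) * (if v ∉ A then convPow m n (y - v) else 0)) := by
          refine tsum_congr fun v => ?_
          conv_lhs => rw [ih' v]
          rw [mul_add, mul_add, Finset.mul_sum]
      _ = _ := by
          rw [ENNReal.tsum_add, ENNReal.tsum_add, h3,
            Summable.tsum_finsetSum fun _ _ => ENNReal.summable, Finset.sum_congr rfl h2]
          simp [killedKern, hx, add_assoc]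

/-- First exit decomposition of the potential kernel. -/
lemma potential_sub_eq (m : V → ℝ≥0∞) {A : Set V} {x : V} (hx : x ∈ A) (y : V) :
    potential m (y - x) = ∑' n, killedKern m A n x y
      + ∑' z, exitLaw m A x z * potential m (y - z) := by
  have h1 : ∑' n, ∑ k ∈ Finset.range n,
        ∑' z, exitKern m A k x z * convPow m (n - 1 - k) (y - z)
      = ∑' k, ∑' j, ∑' z, exitKern m A k x z * convPow m j (y - z) := by
    rw [tsum_eq_zero_add' ENNReal.summable]
    simp only [Finset.range_zero, Finset.sum_empty, zero_add, Nat.add_sub_cancel]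
    set f : ℕ → ℕ → ℝ≥0∞ := fun k j => ∑' z, exitKern m A k x z * convPow m j (y - z)
    rw [← ENNReal.tsum_prod,
      ← Finset.HasAntidiagonal.sigmaAntidiagonalEquivProd.tsum_eq (fun p : ℕ × ℕ => f p.1 p.2),
      ENNReal.tsum_sigma']
    refine tsum_congr fun n => ?_
    rw [← Finset.Nat.sum_antidiagonal_eq_sum_range_succ f n, tsum_fintype, Finset.univ_eq_attach]
    exact (Finset.sum_attach _ fun p : ℕ × ℕ => f p.1 p.2).symm
  have h2 : ∑' z, exitLaw m A x z * potential m (y - z)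
      = ∑' k, ∑' j, ∑' z, exitKern m A k x z * convPow m j (y - z) := by
    have h3 : ∀ z, exitLaw m A x z * potential m (y - z)
        = ∑' k, ∑' j, exitKern m A k x z * convPow m j (y - z) := fun z => by
      rw [exitLaw, potential, ← ENNReal.tsum_mul_right]
      exact tsum_congr fun k => ENNReal.tsum_mul_left.symm
    simp only [h3]
    rw [ENNReal.tsum_comm]
    exact tsum_congr fun k => ENNReal.tsum_comm
  rw [h2, ← h1, ← ENNReal.tsum_add]
  exact tsum_congr fun n => convPow_sub_eq m n hx y

lemma exitLaw_le_potential (m : V → ℝ≥0∞) (A : Set V) (x z : V) :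
    exitLaw m A x z ≤ potential m (z - x) := by
  by_cases hx : x ∈ A
  · rw [potential_sub_eq m hx]
    refine le_trans ?_ le_add_self
    refine le_trans ?_ (ENNReal.le_tsum z)
    rw [sub_self]
    exact le_mul_of_one_le_right' (one_le_potential_zero m)
  · simp [exitLaw, exitKern_of_notMem m hx]

lemma tsum_exitLaw_eq (m : V → ℝ≥0∞) {A : Set V} {x : V} (hx : x ∈ A) :
    ∑' z, exitLaw m A x z
      = ∑' v, m (v - x) * (if v ∈ A then ∑' z, exitLaw m A v z else 1) := by
  have h0 : ∀ v z, m (v - x) * exitLaw m A v z = ∑' n, m (v - x) * exitKern m A n v z :=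
    fun v z => by rw [exitLaw, ENNReal.tsum_mul_left]
  have h1 : ∑' z, exitLaw m A x z
      = ∑' z, exitKern m A 0 x z + ∑' v, ∑' z, m (v - x) * exitLaw m A v z := by
    rw [ENNReal.tsum_comm, ← ENNReal.tsum_add]
    refine tsum_congr fun z => ?_
    rw [exitLaw, tsum_eq_zero_add' ENNReal.summable]
    simp only [h0]
    rw [ENNReal.tsum_comm]
    simp [exitKern, hx]
  rw [h1, ← ENNReal.tsum_add]
  refine tsum_congr fun v => ?_
  by_cases hv : v ∈ A
  · simp [exitKern, hv, ENNReal.tsum_mul_left]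
  · simp [exitKern, hv, hx, exitLaw, exitKern_of_notMem]

lemma tsum_exitLaw_le_one (m : V → ℝ≥0∞) (hm : ∑' z, m z ≤ 1) (A : Set V) (x : V) :
    ∑' z, exitLaw m A x z ≤ 1 := by
  have key : ∀ N x, ∑' z, ∑ k ∈ Finset.range N, exitKern m A k x z ≤ 1 := by
    intro N
    induction N with
    | zero => simp
    | succ N ih =>
      intro x
      by_cases hx : x ∈ A
      swap
      · simp [exitKern_of_notMem m hx]
      calc ∑' z, ∑ k ∈ Finset.range (N + 1), exitKern m A k x z
          = ∑' v, m (v - x) * (if v ∈ A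
              then ∑' z, ∑ k ∈ Finset.range N, exitKern m A k v z else 1) := by
            have h1 : ∀ z, ∑ k ∈ Finset.range (N + 1), exitKern m A k x z
                = (∑' v, m (v - x) * ∑ k ∈ Finset.range N, exitKern m A k v z)
                  + exitKern m A 0 x z := by
              intro z
              rw [Finset.sum_range_succ']
              simp only [Finset.mul_sum]
              rw [Summable.tsum_finsetSum fun _ _ => ENNReal.summable]
              simp [exitKern, hx]
            simp only [h1]
            rw [ENNReal.tsum_add, ENNReal.tsum_comm, ← ENNReal.tsum_add]
            refine tsum_congr fun v => ?_
            by_cases hv : v ∈ A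
            · simp [exitKern, hv, ENNReal.tsum_mul_left]
            · simp [exitKern, hv, hx, exitKern_of_notMem]
        _ ≤ ∑' v, m (v - x) * 1 := by
            refine ENNReal.tsum_le_tsum fun v => ?_
            gcongr
            split_ifs
            · exact ih v
            · exact le_rfl
        _ ≤ 1 := by simpa [tsum_sub_const m x] using hm
  have h2 : ∑' z, exitLaw m A x z = ∑' k, ∑' z, exitKern m A k x z := ENNReal.tsum_comm
  rw [h2, ENNReal.tsum_eq_iSup_nat]
  refine iSup_le fun N => ?_
  rw [← Summable.tsum_finsetSum fun _ _ => ENNReal.summable]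
  exact key N x

lemma killedKern_le_convPow (m : V → ℝ≥0∞) (A : Set V) (n : ℕ) (x y : V) :
    killedKern m A n x y ≤ convPow m n (y - x) := by
  by_cases hx : x ∈ A
  · rw [convPow_sub_eq m n hx]
    exact le_self_add
  · simp [killedKern_of_notMem m hx]

lemma tsum_ofReal_eq_one {α : Type*} {μ : α → ℝ} (hnn : ∀ z, 0 ≤ μ z) (hsum : HasSum μ 1) :
    ∑' z, ENNReal.ofReal (μ z) = 1 := by
  rw [← ENNReal.ofReal_tsum_of_nonneg hnn hsum.summable, hsum.tsum_eq, ENNReal.ofReal_one]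

lemma killedKern_le_one {m : V → ℝ≥0∞} (hm : ∑' z, m z = 1) (A : Set V) (n : ℕ) (x y : V) :
    killedKern m A n x y ≤ 1 := by
  refine (killedKern_le_convPow m A n x y).trans ((ENNReal.le_tsum _).trans ?_)
  rw [tsum_convPow, hm, one_pow]

lemma kern_eq_toReal {μ : V → ℝ} (hnn : ∀ z, 0 ≤ μ z) (hsum : HasSum μ 1) (A : Set V) (n : ℕ)
    (x y : V) : kern μ A n x y = (killedKern (fun z => ENNReal.ofReal (μ z)) A n x y).toReal := by
  induction n generalizing x with
  | zero => simp only [kern, killedKern]; split_ifs <;> simp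
  | succ n ih =>
    simp only [kern, killedKern, ih]
    rw [ENNReal.tsum_toReal_eq]
    · refine tsum_congr fun z => ?_
      rw [ENNReal.toReal_mul]
      congr 1
      split_ifs <;> simp [hnn]
    · intro z
      refine ENNReal.mul_ne_top (by split_ifs <;> simp) ?_
      exact ne_top_of_le_ne_top ENNReal.one_ne_top
        (killedKern_le_one (tsum_ofReal_eq_one hnn hsum) A n z y)

lemma green_eq_toReal {μ : V → ℝ} (hnn : ∀ z, 0 ≤ μ z) (hsum : HasSum μ 1) (A : Set V) (x y : V) :
    green μ A x y = (∑' n, killedKern (fun z => ENNReal.ofReal (μ z)) A n x y).toReal := by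
  rw [ENNReal.tsum_toReal_eq]
  · simp only [green, kern_eq_toReal hnn hsum]
  · exact fun n => ne_top_of_le_ne_top ENNReal.one_ne_top
      (killedKern_le_one (tsum_ofReal_eq_one hnn hsum) A n x y)

lemma exitExp_one_eq_toReal {μ : V → ℝ} (hnn : ∀ z, 0 ≤ μ z) (hsum : HasSum μ 1) (A : Set V)
    (x : V) : exitExp μ A Set.univ (fun _ => 1) x
      = (∑' z, exitLaw (fun z => ENNReal.ofReal (μ z)) A x z).toReal := by
  have hm := tsum_ofReal_eq_one hnn hsum
  set m : V → ℝ≥0∞ := fun z => ENNReal.ofReal (μ z) with hmdef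
  have hin : ∀ z, ∑' y, (if y ∉ A then m (y - z) else 0) ≤ 1 := by
    intro z
    calc _ ≤ ∑' y, m (y - z) := ENNReal.tsum_le_tsum fun y => by split_ifs <;> simp
      _ = 1 := by rw [tsum_sub_const, hm]
  have hin' : ∀ n, ∑' z, killedKern m A n x z * ∑' y, (if y ∉ A then m (y - z) else 0) ≤ 1 := by
    intro n
    calc _ ≤ ∑' z, convPow m n (z - x) * 1 := ENNReal.tsum_le_tsum fun z => by
            gcongr
            · exact killedKern_le_convPow m A n x z
            · exact hin z
      _ = 1 := by simp [tsum_sub_const (convPow m n) x, tsum_convPow, hm]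
  have h1 : ∑' z, exitLaw m A x z
      = ∑' n, ∑' z, killedKern m A n x z * ∑' y, (if y ∉ A then m (y - z) else 0) := by
    simp only [exitLaw]
    rw [ENNReal.tsum_comm]
    refine tsum_congr fun n => ?_
    simp only [← tsum_killedKern_mul, ← ENNReal.tsum_mul_left]
    rw [ENNReal.tsum_comm]
  rw [h1, ENNReal.tsum_toReal_eq fun n => ne_top_of_le_ne_top ENNReal.one_ne_top (hin' n), exitExp]
  refine tsum_congr fun n => ?_
  rw [ENNReal.tsum_toReal_eq fun z => ne_top_of_le_ne_top ENNReal.one_ne_top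
    ((ENNReal.le_tsum z).trans (hin' n))]
  refine tsum_congr fun z => ?_
  rw [ENNReal.toReal_mul, kern_eq_toReal hnn hsum, ENNReal.tsum_toReal_eq fun y =>
    ne_top_of_le_ne_top ENNReal.one_ne_top ((ENNReal.le_tsum y).trans (hin z))]
  congr 1
  refine tsum_congr fun y => ?_
  by_cases hy : y ∈ A <;> simp [hy, hmdef, hnn]

end KilledWalk

section ExponentialMoments

open scoped ENNReal

variable {d : ℕ}

lemma znorm_nonneg (x : Fin d → ℤ) : 0 ≤ znorm x := Finset.sum_nonneg fun _ _ => abs_nonneg _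

lemma znorm_zero : znorm (0 : Fin d → ℤ) = 0 := by simp [znorm]

lemma znorm_add_le (x y : Fin d → ℤ) : znorm (x + y) ≤ znorm x + znorm y := by
  rw [znorm, znorm, znorm, ← Finset.sum_add_distrib]
  refine Finset.sum_le_sum fun i _ => ?_
  push_cast [Pi.add_apply]
  exact abs_add_le _ _

lemma znorm_neg (x : Fin d → ℤ) : znorm (-x) = znorm x := by simp [znorm]

lemma abs_apply_le_znorm (x : Fin d → ℤ) (i : Fin d) : |(x i : ℝ)| ≤ znorm x :=
  Finset.single_le_sum (f := fun i => |(x i : ℝ)|) (fun _ _ => abs_nonneg _) (Finset.mem_univ i)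

lemma exists_summable_exp_znorm {μ : (Fin d → ℤ) → ℝ} (hnn : ∀ z, 0 ≤ μ z) (hsum : HasSum μ 1)
    (hA2 : A2 μ) : ∃ ρ > 0, Summable fun z => μ z * Real.exp (ρ * znorm z) := by
  obtain ⟨U, hU, hDU, hfin⟩ := hA2
  have h0 : (0 : Fin d → ℝ) ∈ U := by
    refine hDU ?_
    simp only [Dset, phiE, dotZ, Set.mem_ofPred_eq, Pi.zero_apply, zero_mul, Finset.sum_const_zero,
      Real.exp_zero, mul_one]
    exact (tsum_ofReal_eq_one hnn hsum).le
  obtain ⟨r, hr, hball⟩ := Metric.isOpen_iff.1 hU 0 h0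
  refine ⟨r / 2, by positivity, ?_⟩
  set a : (Fin d → Bool) → Fin d → ℝ := fun σ i => if σ i then r / 2 else -(r / 2)
  have ha : ∀ σ, a σ ∈ U := by
    intro σ
    refine hball ?_
    rw [mem_ball_zero_iff, pi_norm_lt_iff hr]
    intro i
    by_cases h : σ i <;> simp [a, h, abs_of_pos hr] <;> linarith
  have hs : ∀ σ, Summable fun z => μ z * Real.exp (dotZ (a σ) z) := by
    intro σ
    have := ENNReal.summable_toReal (hfin _ (ha σ))
    refine this.congr fun z => ENNReal.toReal_ofReal ?_
    exact mul_nonneg (hnn z) (Real.exp_pos _).le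
  have htot : Summable fun z => ∑ σ, μ z * Real.exp (dotZ (a σ) z) := summable_sum fun σ _ => hs σ
  refine htot.of_nonneg_of_le (fun z => mul_nonneg (hnn z) (Real.exp_pos _).le) fun z => ?_
  have hz : r / 2 * znorm z = dotZ (a fun i => decide (0 ≤ z i)) z := by
    rw [znorm, dotZ, Finset.mul_sum]
    refine Finset.sum_congr rfl fun i _ => ?_
    by_cases h : 0 ≤ z i
    · have : (0 : ℝ) ≤ z i := by exact_mod_cast h
      simp [a, h, abs_of_nonneg this]
    · have : (z i : ℝ) ≤ 0 := by exact_mod_cast (not_le.1 h).le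
      simp [a, h, abs_of_nonpos this]
  rw [hz]
  exact Finset.single_le_sum (f := fun σ => μ z * Real.exp (dotZ (a σ) z))
    (fun σ _ => mul_nonneg (hnn z) (Real.exp_pos _).le) (Finset.mem_univ _)

lemma abs_exp_sub_one_le_mul_exp (x : ℝ) : |Real.exp x - 1| ≤ |x| * Real.exp |x| := by
  have h1 := Real.add_one_le_exp x
  have h2 := Real.add_one_le_exp (-x)
  have h3 : 1 ≤ Real.exp |x| := Real.one_le_exp (abs_nonneg x)
  have h4 : Real.exp x ≤ Real.exp |x| := Real.exp_le_exp.2 (le_abs_self x)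
  have h5 : Real.exp (-x) * Real.exp x = 1 := by rw [← Real.exp_add]; simp
  have h6 := Real.exp_pos x
  rw [abs_le]
  constructor
  · nlinarith [neg_abs_le x, abs_nonneg x]
  · have : Real.exp x - 1 ≤ x * Real.exp x := by nlinarith
    refine this.trans ?_
    nlinarith [le_abs_self x, abs_nonneg x]

variable {μ : (Fin d → ℤ) → ℝ} {ρ : ℝ}

/-- Functions of at most linear growth have finite mean. -/
lemma summable_mul_of_linear_growth (hnn : ∀ z, 0 ≤ μ z) (hρ : 0 < ρ)
    (hexp : Summable fun z => μ z * Real.exp (ρ * znorm z)) {g : (Fin d → ℤ) → ℝ} {K : ℝ}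
    (hK : 0 < K) (hg : ∀ z, |g z| ≤ K * (1 + znorm z)) : Summable fun z => μ z * g z := by
  refine Summable.of_norm_bounded (hexp.mul_left (K * (1 + 1 / ρ))) fun z => ?_
  rw [Real.norm_eq_abs, abs_mul, abs_of_nonneg (hnn z)]
  have h1 := Real.add_one_le_exp (ρ * znorm z)
  have h0 : 0 ≤ ρ * znorm z := mul_nonneg hρ.le (znorm_nonneg z)
  have h2 : znorm z ≤ 1 / ρ * Real.exp (ρ * znorm z) := by
    rw [one_div, inv_mul_eq_div, le_div_iff₀ hρ]
    linarith
  calc μ z * |g z| ≤ μ z * (K * (1 + znorm z)) := by gcongr; exacts [hnn z, hg z]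
    _ ≤ μ z * (K * (Real.exp (ρ * znorm z) + 1 / ρ * Real.exp (ρ * znorm z))) := by
        gcongr
        · exact hnn z
        · linarith
    _ = _ := by ring

/-- A function with negative mean has an exponential moment smaller than one. -/
lemma exists_tsum_exp_lt_one_of_neg (hnn : ∀ z, 0 ≤ μ z) (hsum : HasSum μ 1) (hρ : 0 < ρ)
    (hexp : Summable fun z => μ z * Real.exp (ρ * znorm z)) {g : (Fin d → ℤ) → ℝ} {K : ℝ}
    (hK : 0 < K) (hg : ∀ z, |g z| ≤ K * (1 + znorm z)) (hneg : ∑' z, μ z * g z < 0) :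
    ∃ θ > 0, ∑' z, ENNReal.ofReal (μ z) * ENNReal.ofReal (Real.exp (θ * g z)) < 1 := by
  set r := ρ / (2 * K) with hr
  have hr0 : 0 < r := by positivity
  have hlim : Tendsto (fun θ : ℝ => ∑' z, μ z * ((Real.exp (θ * g z) - 1) / θ)) (𝓝[>] 0)
      (𝓝 (∑' z, μ z * g z)) := by
    refine tendsto_tsum_of_dominated_convergence
      (bound := fun z => μ z * (1 / r * Real.exp ρ * Real.exp (ρ * znorm z))) ?_ ?_ ?_
    · refine (hexp.mul_left (1 / r * Real.exp ρ)).congr fun z => by ring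
    · intro z
      refine Tendsto.const_mul _ ?_
      have hd : HasDerivAt (fun θ : ℝ => Real.exp (θ * g z)) (g z) 0 := by
        simpa using ((hasDerivAt_id (0 : ℝ)).mul_const (g z)).exp
      refine hd.tendsto_slope_zero_right.congr fun θ => ?_
      simp [div_eq_inv_mul]
    · have hmem : Set.Ioc 0 r ∈ 𝓝[>] (0 : ℝ) := Ioc_mem_nhdsGT hr0
      filter_upwards [hmem] with θ hθ z
      rw [Real.norm_eq_abs, abs_mul, abs_of_nonneg (hnn z), abs_div, abs_of_pos hθ.1]
      refine mul_le_mul_of_nonneg_left ?_ (hnn z)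
      rw [div_le_iff₀ hθ.1]
      refine (abs_exp_sub_one_le_mul_exp _).trans ?_
      rw [abs_mul, abs_of_pos hθ.1]
      have h1 : |g z| ≤ 1 / r * Real.exp (r * |g z|) := by
        rw [one_div, inv_mul_eq_div, le_div_iff₀ hr0]
        linarith [Real.add_one_le_exp (r * |g z|)]
      have h2 : Real.exp (θ * |g z|) ≤ Real.exp (r * |g z|) := by
        gcongr
        exact hθ.2
      have h3 : Real.exp (r * |g z|) * Real.exp (r * |g z|)
          ≤ Real.exp ρ * Real.exp (ρ * znorm z) := by
        rw [← Real.exp_add, ← Real.exp_add, Real.exp_le_exp]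
        calc r * |g z| + r * |g z| ≤ r * (K * (1 + znorm z)) + r * (K * (1 + znorm z)) := by
              gcongr <;> exact hg z
          _ = ρ + ρ * znorm z := by rw [hr]; field_simp; ring
      calc θ * |g z| * Real.exp (θ * |g z|)
          ≤ θ * (1 / r * Real.exp (r * |g z|)) * Real.exp (r * |g z|) := by
            have := hθ.1
            gcongr
        _ = (1 / r * (Real.exp (r * |g z|) * Real.exp (r * |g z|))) * θ := by ring
        _ ≤ (1 / r * (Real.exp ρ * Real.exp (ρ * znorm z))) * θ := by
            have := hθ.1
            gcongr
        _ = _ := by ring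
  have hev : ∀ᶠ θ : ℝ in 𝓝[>] 0, ∑' z, μ z * ((Real.exp (θ * g z) - 1) / θ) < 0 :=
    hlim.eventually (gt_mem_nhds hneg)
  obtain ⟨θ, hθneg, hθ0, hθr⟩ := (hev.and (Ioc_mem_nhdsGT hr0)).exists
  refine ⟨θ, hθ0, ?_⟩
  have hs : Summable fun z => μ z * Real.exp (θ * g z) := by
    refine (hexp.mul_left (Real.exp ρ)).of_nonneg_of_le
      (fun z => mul_nonneg (hnn z) (Real.exp_pos _).le) fun z => ?_
    rw [mul_left_comm, ← Real.exp_add]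
    refine mul_le_mul_of_nonneg_left (Real.exp_le_exp.2 ?_) (hnn z)
    calc θ * g z ≤ r * |g z| := by
          refine (mul_le_mul_of_nonneg_left (le_abs_self _) hθ0.le).trans ?_
          gcongr
      _ ≤ r * (K * (1 + znorm z)) := by gcongr; exact hg z
      _ ≤ ρ + ρ * znorm z := by
          have h1 : r * (K * (1 + znorm z)) = (ρ + ρ * znorm z) / 2 := by rw [hr]; field_simp
          have := mul_nonneg hρ.le (znorm_nonneg z)
          linarith
  have h2 : ∑' z, μ z * ((Real.exp (θ * g z) - 1) / θ)
      = (∑' z, μ z * Real.exp (θ * g z) - 1) / θ := by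
    conv_rhs => rw [← hsum.tsum_eq, ← hs.tsum_sub hsum.summable, ← tsum_div_const]
    exact tsum_congr fun z => by ring
  have h3 : ∑' z, μ z * Real.exp (θ * g z) < 1 := by
    rw [h2, div_lt_iff₀ hθ0] at hθneg
    linarith
  have h4 : ∑' z, ENNReal.ofReal (μ z) * ENNReal.ofReal (Real.exp (θ * g z))
      = ENNReal.ofReal (∑' z, μ z * Real.exp (θ * g z)) := by
    rw [ENNReal.ofReal_tsum_of_nonneg (fun z => mul_nonneg (hnn z) (Real.exp_pos _).le) hs]
    exact tsum_congr fun z => (ENNReal.ofReal_mul (hnn z)).symm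
  rw [h4]
  exact ENNReal.ofReal_lt_one.2 h3

/-- A function with negative mean has an exponential moment smaller than one, with some room left
for a small exponential weight. -/
lemma exists_tsum_exp_add_znorm_lt_one (hnn : ∀ z, 0 ≤ μ z) (hsum : HasSum μ 1) (hρ : 0 < ρ)
    (hexp : Summable fun z => μ z * Real.exp (ρ * znorm z)) {g : (Fin d → ℤ) → ℝ} {K : ℝ}
    (hK : 0 < K) (hg : ∀ z, |g z| ≤ K * (1 + znorm z)) (hneg : ∑' z, μ z * g z < 0) :
    ∃ θ > 0, ∃ κ > 0,
      ∑' z, ENNReal.ofReal (μ z) * ENNReal.ofReal (Real.exp (θ * g z + κ * znorm z)) < 1 := by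
  have hN : Summable fun z => μ z * znorm z :=
    summable_mul_of_linear_growth hnn hρ hexp one_pos fun z => by
      rw [abs_of_nonneg (znorm_nonneg z)]; linarith
  have hgs := summable_mul_of_linear_growth hnn hρ hexp hK hg
  set N := ∑' z, μ z * znorm z with hNdef
  set m := ∑' z, μ z * g z with hmdef
  have hN0 : 0 ≤ N := tsum_nonneg fun z => mul_nonneg (hnn z) (znorm_nonneg z)
  set κ := -m / (2 * (1 + N)) with hκ
  have hκ0 : 0 < κ := div_pos (by linarith) (by linarith)
  have hmean : ∑' z, μ z * (g z + κ * znorm z) < 0 := by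
    have h1 : ∑' z, μ z * (g z + κ * znorm z) = m + κ * N := by
      rw [hmdef, hNdef, ← tsum_mul_left, ← hgs.tsum_add (hN.mul_left κ)]
      exact tsum_congr fun z => by ring
    have h2 : κ * (1 + N) = -m / 2 := by rw [hκ]; field_simp
    rw [h1]
    nlinarith
  obtain ⟨θ, hθ, h⟩ := exists_tsum_exp_lt_one_of_neg hnn hsum hρ hexp
    (g := fun z => g z + κ * znorm z) (K := K + κ) (by positivity) (fun z => by
      refine (abs_add_le _ _).trans ?_
      rw [abs_mul, abs_of_pos hκ0, abs_of_nonneg (znorm_nonneg z)]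
      linarith [hg z]) hmean
  refine ⟨θ, hθ, θ * κ, by positivity, ?_⟩
  refine lt_of_eq_of_lt (tsum_congr fun z => ?_) h
  congr 3; ring

end ExponentialMoments

section PotentialRegularity

open scoped ENNReal

variable {d : ℕ}

/-- A probability weight on `ℤ^d` with an exponential moment of order `ρ`. -/
structure LightTailed (μ : (Fin d → ℤ) → ℝ) (ρ : ℝ) : Prop where
  nonneg : ∀ z, 0 ≤ μ z
  hasSum : HasSum μ 1
  pos : 0 < ρ
  summable_exp : Summable fun z => μ z * Real.exp (ρ * znorm z)

lemma induction_on_steps {μ : (Fin d → ℤ) → ℝ} (hA1 : A1 μ) {P : (Fin d → ℤ) → Prop} (h0 : P 0)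
    (hs : ∀ x s, P x → 0 < μ s → P (x + s)) (x : Fin d → ℤ) : P x := by
  obtain ⟨k, c, hc0, hck, -, hstep⟩ := hA1 ∅ 0 (by simp [posDom]) x (by simp [posDom])
  have key : ∀ j ≤ k, P (c j) := by
    intro j
    induction j with
    | zero => intro _; rwa [hc0]
    | succ j ih =>
      intro hj
      have := hs (c j) (c (j + 1) - c j) (ih (by omega)) (hstep j (by omega))
      rwa [add_sub_cancel] at this
  exact hck ▸ key k le_rfl

/-- A function that varies by a bounded factor along unit steps varies at most exponentially. -/
lemma le_exp_znorm_mul {f : (Fin d → ℤ) → ℝ} {b : ℝ}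
    (hp : ∀ i y, f (y + Pi.single i 1) ≤ Real.exp b * f y)
    (hn : ∀ i y, f (y + Pi.single i (-1)) ≤ Real.exp b * f y) (x y : Fin d → ℤ) :
    f (y + x) ≤ Real.exp (b * znorm x) * f y := by
  have hnat : ∀ (u : Fin d → ℤ), (∀ y, f (y + u) ≤ Real.exp b * f y) →
      ∀ (n : ℕ) y, f (y + n • u) ≤ Real.exp (b * n) * f y := by
    intro u hu n
    induction n with
    | zero => simp
    | succ n ih =>
      intro y
      rw [succ_nsmul, ← add_assoc]
      calc _ ≤ Real.exp b * f (y + n • u) := hu _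
        _ ≤ Real.exp b * (Real.exp (b * n) * f y) := by gcongr; exact ih y
        _ = _ := by rw [← mul_assoc, ← Real.exp_add]; push_cast; ring_nf
  have hint : ∀ (i : Fin d) (k : ℤ) y,
      f (y + Pi.single i k) ≤ Real.exp (b * |(k : ℝ)|) * f y := by
    intro i k y
    obtain ⟨n, rfl | rfl⟩ := k.eq_nat_or_neg
    · have := hnat (Pi.single i 1) (hp i) n y
      rw [← Pi.single_smul] at this
      simpa using this
    · have := hnat (Pi.single i (-1)) (hn i) n y
      rw [← Pi.single_smul] at this
      simpa using this
  have hfin : ∀ (s : Finset (Fin d)) y, f (y + ∑ i ∈ s, Pi.single i (x i))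
      ≤ Real.exp (b * ∑ i ∈ s, |(x i : ℝ)|) * f y := by
    intro s
    induction s using Finset.induction_on with
    | empty => simp
    | insert i s hi ih =>
      intro y
      rw [Finset.sum_insert hi, Finset.sum_insert hi, ← add_assoc, add_right_comm]
      calc _ ≤ Real.exp (b * |(x i : ℝ)|) * f (y + ∑ i ∈ s, Pi.single i (x i)) := hint i _ _
        _ ≤ Real.exp (b * |(x i : ℝ)|) * (Real.exp (b * ∑ i ∈ s, |(x i : ℝ)|) * f y) := by
            gcongr; exact ih y
        _ = _ := by rw [← mul_assoc, ← Real.exp_add, mul_add]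
  have := hfin Finset.univ y
  rwa [Finset.univ_sum_single] at this

variable {μ : (Fin d → ℤ) → ℝ} {ρ : ℝ}

/-- Real-valued potential kernel of the random walk with step distribution `μ`. -/
noncomputable def realPotential (μ : (Fin d → ℤ) → ℝ) (y : Fin d → ℤ) : ℝ :=
  (potential (fun z => ENNReal.ofReal (μ z)) y).toReal

lemma realPotential_nonneg (y : Fin d → ℤ) : 0 ≤ realPotential μ y := ENNReal.toReal_nonneg

lemma tsum_mul_coord (μ : (Fin d → ℤ) → ℝ) (i : Fin d) (a : ℝ) :
    ∑' z : Fin d → ℤ, μ z * (a * (z i : ℝ)) = a * Mvec μ i := by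
  rw [Mvec, ← tsum_mul_left]
  exact tsum_congr fun z => by ring

/-- Bound on the potential of a weight that has a submultiplicative moment smaller than one. -/
lemma tsum_potential_mul_exp_lt_top (m : (Fin d → ℤ) → ℝ≥0∞) {F : (Fin d → ℤ) → ℝ} (h0 : F 0 = 0)
    (hF : ∀ x y, F (x + y) ≤ F x + F y)
    (h : ∑' z, m z * ENNReal.ofReal (Real.exp (F z)) < 1) :
    ∑' z, potential m z * ENNReal.ofReal (Real.exp (F z)) < ⊤ := by
  refine (tsum_potential_mul_le m _ (by simp [h0]) fun x y => ?_).trans_lt ?_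
  · rw [← ENNReal.ofReal_mul (Real.exp_pos _).le, ← Real.exp_add]
    exact ENNReal.ofReal_le_ofReal (Real.exp_le_exp.2 (hF x y))
  · rw [ENNReal.inv_lt_top]
    exact tsub_pos_of_lt h

lemma LightTailed.potential_ne_top (hμ : LightTailed μ ρ) {i : Fin d} (hM : 0 < Mvec μ i)
    (y : Fin d → ℤ) : potential (fun z => ENNReal.ofReal (μ z)) y ≠ ⊤ := by
  obtain ⟨θ, hθ, h⟩ := exists_tsum_exp_lt_one_of_neg hμ.nonneg hμ.hasSum hμ.pos hμ.summable_exp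
    (g := fun z => -1 * (z i : ℝ)) one_pos (fun z => by
      simpa using (abs_apply_le_znorm z i).trans (by linarith)) (by
      rw [tsum_mul_coord]; linarith)
  have h2 := tsum_potential_mul_exp_lt_top (fun z => ENNReal.ofReal (μ z))
    (F := fun z => θ * (-1 * (z i : ℝ))) (by simp) (fun x y => by
      push_cast [Pi.add_apply]
      linarith) h
  intro htop
  refine ((ENNReal.le_tsum y).trans_lt h2).ne ?_
  rw [htop]
  exact ENNReal.top_mul (by simp [Real.exp_pos])

lemma LightTailed.one_le_realPotential_zero (hμ : LightTailed μ ρ) {i : Fin d}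
    (hM : 0 < Mvec μ i) : 1 ≤ realPotential μ 0 := by
  rw [realPotential, ← ENNReal.toReal_one]
  exact ENNReal.toReal_mono (hμ.potential_ne_top hM 0) (one_le_potential_zero _)

lemma LightTailed.mul_realPotential_le (hμ : LightTailed μ ρ) {i : Fin d} (hM : 0 < Mvec μ i)
    (s y : Fin d → ℤ) : μ s * realPotential μ (y - s) ≤ realPotential μ y := by
  have := ENNReal.toReal_mono (hμ.potential_ne_top hM y)
    (mul_potential_le (fun z => ENNReal.ofReal (μ z)) s y)
  rwa [ENNReal.toReal_mul, ENNReal.toReal_ofReal (hμ.nonneg s)] at this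

lemma LightTailed.realPotential_sub_step_le (hμ : LightTailed μ ρ) {i : Fin d}
    (hM : 0 < Mvec μ i) {s : Fin d → ℤ} (hs : 0 < μ s) {b : ℝ} (hb : 0 < b) :
    ∃ C ≥ 0, ∃ κ > 0, ∀ y, realPotential μ (y - s)
      ≤ Real.exp b * realPotential μ y + C * Real.exp (-(κ * znorm y)) := by
  set c := μ s * Real.exp b with hc
  have hc0 : 0 < c := by positivity
  have hcs : μ s < c := by
    have := Real.one_lt_exp_iff.2 hb
    rw [hc]; nlinarith
  have hmean : ∑' z, μ z * ((if z = s then 1 else 0) - c) < 0 := by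
    have h1 : ∀ z, μ z * ((if z = s then 1 else 0) - c) = (if z = s then μ s else 0) - μ z * c := by
      intro z; split_ifs with h <;> simp [h]; ring
    simp only [h1]
    have h2 : HasSum (fun z => if z = s then μ s else 0) (μ s) := hasSum_ite_eq s (μ s)
    rw [(h2.sub (hμ.hasSum.mul_right c)).tsum_eq]
    linarith
  obtain ⟨θ, hθ, κ, hκ, h⟩ := exists_tsum_exp_add_znorm_lt_one hμ.nonneg hμ.hasSum hμ.pos
    hμ.summable_exp (g := fun z => (if z = s then 1 else 0) - c) (K := 1 + c) (by positivity)
    (fun z => by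
      have hN := znorm_nonneg z
      refine (abs_sub _ _).trans ?_
      rw [abs_of_pos hc0]
      have : |(if z = s then (1 : ℝ) else 0)| ≤ 1 := by split_ifs <;> simp
      nlinarith [mul_nonneg hc0.le hN]) hmean
  set m : (Fin d → ℤ) → ℝ≥0∞ := fun z => ENNReal.ofReal (μ z)
  set l : (Fin d → ℤ) → ℝ≥0∞ :=
    fun z => m z * ENNReal.ofReal (Real.exp (θ * ((if z = s then 1 else 0) - c)))
  have hl : ∑' z, l z * ENNReal.ofReal (Real.exp (κ * znorm z)) < 1 := by
    refine lt_of_eq_of_lt (tsum_congr fun z => ?_) h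
    rw [Real.exp_add, ENNReal.ofReal_mul (Real.exp_pos _).le, ← mul_assoc]
  set D := ∑' z, potential l z * ENNReal.ofReal (Real.exp (κ * znorm z))
  have hD : D < ⊤ := tsum_potential_mul_exp_lt_top l (by simp [znorm_zero])
    (fun x y => by
      rw [← mul_add]
      exact mul_le_mul_of_nonneg_left (znorm_add_le x y) hκ.le) hl
  have hly : ∀ y, potential l y ≤ D * ENNReal.ofReal (Real.exp (-(κ * znorm y))) := by
    intro y
    have h1 : potential l y * ENNReal.ofReal (Real.exp (κ * znorm y)) ≤ D := ENNReal.le_tsum y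
    refine le_trans (le_of_eq ?_) (mul_le_mul_left h1 _)
    rw [mul_assoc, ← ENNReal.ofReal_mul (Real.exp_pos _).le, ← Real.exp_add]
    simp
  refine ⟨D.toReal / (θ * μ s), by positivity, κ, hκ, fun y => ?_⟩
  have hG := hμ.potential_ne_top hM y
  have h0 : ENNReal.ofReal θ * (m s * potential m (y - s))
      ≤ ENNReal.ofReal (θ * c) * potential m y + potential l y := by
    convert mul_potential_sub_le m s y hθ.le hc0.le
  have h1 := h0.trans (add_le_add_right (hly y) _)
  have h2 := ENNReal.toReal_mono (by
    refine ENNReal.add_ne_top.2 ⟨ENNReal.mul_ne_top ENNReal.ofReal_ne_top hG,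
      ENNReal.mul_ne_top hD.ne ENNReal.ofReal_ne_top⟩) h1
  rw [ENNReal.toReal_add (ENNReal.mul_ne_top ENNReal.ofReal_ne_top hG)
    (ENNReal.mul_ne_top hD.ne ENNReal.ofReal_ne_top), ENNReal.toReal_mul, ENNReal.toReal_mul,
    ENNReal.toReal_mul, ENNReal.toReal_mul, ENNReal.toReal_ofReal hθ.le,
    ENNReal.toReal_ofReal hs.le, ENNReal.toReal_ofReal (by positivity),
    ENNReal.toReal_ofReal (Real.exp_pos _).le] at h2
  change θ * (μ s * realPotential μ (y - s)) ≤ θ * c * realPotential μ y + _ at h2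
  have hθs : 0 < θ * μ s := by positivity
  rw [← mul_le_mul_iff_right₀ hθs]
  calc _ = θ * (μ s * realPotential μ (y - s)) := by ring
    _ ≤ _ := h2
    _ = _ := by rw [hc]; field_simp

lemma LightTailed.realPotential_sub_le (hμ : LightTailed μ ρ) (hA1 : A1 μ) {i : Fin d}
    (hM : 0 < Mvec μ i) (x : Fin d → ℤ) {b : ℝ} (hb : 0 < b) :
    ∃ C ≥ 0, ∃ κ > 0, ∀ y, realPotential μ (y - x)
      ≤ Real.exp b * realPotential μ y + C * Real.exp (-(κ * znorm y)) := by
  revert b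
  refine induction_on_steps hA1 (P := fun x => ∀ {b : ℝ}, 0 < b → ∃ C ≥ 0, ∃ κ > 0, ∀ y,
    realPotential μ (y - x)
      ≤ Real.exp b * realPotential μ y + C * Real.exp (-(κ * znorm y))) ?_ ?_ x
  · intro b hb
    refine ⟨0, le_rfl, 1, one_pos, fun y => ?_⟩
    have := Real.one_le_exp hb.le
    have := realPotential_nonneg (μ := μ) y
    rw [sub_zero, zero_mul, add_zero]
    nlinarith
  · intro x s ihx hs b hb
    obtain ⟨C₁, hC₁, κ₁, hκ₁, h₁⟩ := ihx (half_pos hb)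
    obtain ⟨C₂, hC₂, κ₂, hκ₂, h₂⟩ := hμ.realPotential_sub_step_le hM hs (half_pos hb)
    refine ⟨Real.exp (b / 2) * C₂ + C₁ * Real.exp (κ₁ * znorm s), by positivity, min κ₁ κ₂,
      lt_min hκ₁ hκ₂, fun y => ?_⟩
    have hN := znorm_nonneg y
    have e1 : Real.exp (-(κ₁ * znorm (y - s)))
        ≤ Real.exp (κ₁ * znorm s) * Real.exp (-(min κ₁ κ₂ * znorm y)) := by
      rw [← Real.exp_add, Real.exp_le_exp]
      have h3 := znorm_add_le (y - s) s
      rw [sub_add_cancel] at h3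
      have h4 : min κ₁ κ₂ * znorm y ≤ κ₁ * znorm y := by gcongr; exact min_le_left _ _
      nlinarith
    have e2 : Real.exp (-(κ₂ * znorm y)) ≤ Real.exp (-(min κ₁ κ₂ * znorm y)) := by
      rw [Real.exp_le_exp, neg_le_neg_iff]
      gcongr
      exact min_le_right _ _
    calc realPotential μ (y - (x + s)) = realPotential μ (y - s - x) := by
          congr 1; abel
      _ ≤ Real.exp (b / 2) * realPotential μ (y - s) + C₁ * Real.exp (-(κ₁ * znorm (y - s))) :=
          h₁ _
      _ ≤ Real.exp (b / 2) * (Real.exp (b / 2) * realPotential μ y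
            + C₂ * Real.exp (-(min κ₁ κ₂ * znorm y)))
          + C₁ * (Real.exp (κ₁ * znorm s) * Real.exp (-(min κ₁ κ₂ * znorm y))) := by
          gcongr
          exact (h₂ y).trans (by gcongr)
      _ = Real.exp (b / 2) * Real.exp (b / 2) * realPotential μ y
          + (Real.exp (b / 2) * C₂ + C₁ * Real.exp (κ₁ * znorm s))
            * Real.exp (-(min κ₁ κ₂ * znorm y)) := by ring
      _ = _ := by rw [← Real.exp_add, add_halves]

/-- Up to an exponentially small correction, the potential kernel varies at most at an arbitrarily
small exponential rate. -/
lemma LightTailed.exists_corrected_potential (hμ : LightTailed μ ρ) (hA1 : A1 μ) {i : Fin d}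
    (hM : 0 < Mvec μ i) {b : ℝ} (hb : 0 < b) :
    ∃ B ≥ 0, ∃ κ > 0, ∀ x y,
      realPotential μ (y + x) + B * Real.exp (-(κ * znorm (y + x)))
        ≤ Real.exp (b * znorm x) * (realPotential μ y + B * Real.exp (-(κ * znorm y))) := by
  have hunit : ∀ u : Fin d → ℤ, ∀ᶠ κ : ℝ in 𝓝[>] 0, ∀ᶠ C : ℝ in atTop, ∀ y,
      realPotential μ (y + u)
        ≤ Real.exp (b / 2) * realPotential μ y + C * Real.exp (-(κ * znorm y)) := by
    intro u
    obtain ⟨C₀, -, κ₀, hκ₀, h⟩ := hμ.realPotential_sub_le hA1 hM (-u) (half_pos hb)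
    filter_upwards [Ioc_mem_nhdsGT hκ₀] with κ hκ
    filter_upwards [eventually_ge_atTop C₀, eventually_ge_atTop 0] with C hC hC' y
    rw [← sub_neg_eq_add]
    refine (h y).trans ?_
    have := znorm_nonneg y
    gcongr
    exact hκ.2
  have hall : ∀ᶠ κ : ℝ in 𝓝[>] 0, ∀ᶠ C : ℝ in atTop, ∀ j : Fin d, ∀ y,
      (realPotential μ (y + Pi.single j 1)
        ≤ Real.exp (b / 2) * realPotential μ y + C * Real.exp (-(κ * znorm y))) ∧
      (realPotential μ (y + Pi.single j (-1))
        ≤ Real.exp (b / 2) * realPotential μ y + C * Real.exp (-(κ * znorm y))) := by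
    have h1 := eventually_all.2 fun j : Fin d => hunit (Pi.single j 1)
    have h2 := eventually_all.2 fun j : Fin d => hunit (Pi.single j (-1))
    filter_upwards [h1, h2] with κ hκ1 hκ2
    filter_upwards [eventually_all.2 hκ1, eventually_all.2 hκ2] with C hC1 hC2 j y
    exact ⟨hC1 j y, hC2 j y⟩
  obtain ⟨κ, hκ, hκ0, hκb⟩ := (hall.and (Ioc_mem_nhdsGT (half_pos hb))).exists
  obtain ⟨C, hC, hC0⟩ := (hκ.and (eventually_ge_atTop 0)).exists
  have hgap : 0 < Real.exp b - Real.exp (b / 2) := sub_pos.2 (Real.exp_lt_exp.2 (by linarith))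
  have hB : 0 ≤ C / (Real.exp b - Real.exp (b / 2)) := by positivity
  set B := C / (Real.exp b - Real.exp (b / 2)) with hBdef
  have hstep : ∀ u : Fin d → ℤ, znorm u = 1 → ∀ y, realPotential μ (y + u)
      ≤ Real.exp (b / 2) * realPotential μ y + C * Real.exp (-(κ * znorm y)) →
      realPotential μ (y + u) + B * Real.exp (-(κ * znorm (y + u)))
        ≤ Real.exp b * (realPotential μ y + B * Real.exp (-(κ * znorm y))) := by
    intro u hu y hy
    have e1 : Real.exp (-(κ * znorm (y + u))) ≤ Real.exp (b / 2) * Real.exp (-(κ * znorm y)) := by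
      rw [← Real.exp_add, Real.exp_le_exp]
      have h3 := znorm_add_le (y + u) (-u)
      rw [add_neg_cancel_right, znorm_neg, hu] at h3
      nlinarith
    have e2 : Real.exp (b / 2) * realPotential μ y ≤ Real.exp b * realPotential μ y := by
      have := realPotential_nonneg (μ := μ) y
      gcongr
      linarith
    calc _ ≤ Real.exp b * realPotential μ y + C * Real.exp (-(κ * znorm y))
          + B * (Real.exp (b / 2) * Real.exp (-(κ * znorm y))) := by
            gcongr
            exact hy.trans (by gcongr)
      _ = Real.exp b * realPotential μ y
          + (B * (Real.exp b - Real.exp (b / 2)) + B * Real.exp (b / 2))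
            * Real.exp (-(κ * znorm y)) := by
            rw [hBdef, div_mul_cancel₀ _ hgap.ne']; ring
      _ = _ := by ring
  have hsingle : ∀ (j : Fin d) (k : ℤ), znorm (Pi.single j k : Fin d → ℤ) = |(k : ℝ)| := by
    intro j k
    rw [znorm, Finset.sum_eq_single j]
    · simp
    · intro l _ hl; simp [hl]
    · simp
  refine ⟨B, hB, κ, hκ0, le_exp_znorm_mul
    (f := fun y => realPotential μ y + B * Real.exp (-(κ * znorm y))) ?_ ?_⟩
  · exact fun j y => hstep _ (by simp [hsingle]) y (hC j y).1
  · exact fun j y => hstep _ (by simp [hsingle]) y (hC j y).2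

/-- Harnack inequality for the potential kernel. -/
lemma LightTailed.exists_exp_le_realPotential (hμ : LightTailed μ ρ) (hA1 : A1 μ) {i : Fin d}
    (hM : 0 < Mvec μ i) : ∃ β ≥ 0, ∀ y, Real.exp (-(β * znorm y)) ≤ realPotential μ y := by
  have hall : ∀ u : Fin d → ℤ, ∀ᶠ β : ℝ in atTop, ∀ y,
      realPotential μ (y + u) ≤ Real.exp β * realPotential μ y := by
    intro u
    have h : ∃ β : ℝ, ∀ y, realPotential μ (y - (-u)) ≤ Real.exp β * realPotential μ y := by
      refine induction_on_steps hA1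
        (P := fun x => ∃ β : ℝ, ∀ y, realPotential μ (y - x) ≤ Real.exp β * realPotential μ y)
        ⟨0, by simp⟩ ?_ (-u)
      rintro x s ⟨β, hβ⟩ hs
      refine ⟨β - Real.log (μ s), fun y => ?_⟩
      rw [Real.exp_sub, Real.exp_log hs, div_mul_eq_mul_div, le_div_iff₀ hs]
      have h1 := hβ (y - s)
      have h2 := hμ.mul_realPotential_le hM s y
      rw [sub_sub, add_comm] at h1
      have h3 := Real.exp_pos β
      calc _ ≤ Real.exp β * realPotential μ (y - s) * μ s := by gcongr
        _ = Real.exp β * (μ s * realPotential μ (y - s)) := by ring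
        _ ≤ _ := by gcongr
    obtain ⟨β₀, h⟩ := h
    filter_upwards [eventually_ge_atTop β₀] with β hβ y
    rw [← sub_neg_eq_add]
    refine (h y).trans ?_
    have := realPotential_nonneg (μ := μ) y
    gcongr
  obtain ⟨β, ⟨h1, h2⟩, hβ⟩ :=
    (((eventually_all.2 fun j : Fin d => hall (Pi.single j 1)).and
      (eventually_all.2 fun j : Fin d => hall (Pi.single j (-1)))).and
      (eventually_ge_atTop (0 : ℝ))).exists
  refine ⟨β, hβ, fun y => ?_⟩
  have h := le_exp_znorm_mul h1 h2 (-y) y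
  rw [add_neg_cancel, znorm_neg] at h
  have h3 := (hμ.one_le_realPotential_zero hM).trans h
  rw [Real.exp_neg, inv_le_iff_one_le_mul₀ (Real.exp_pos _)]
  linarith

end PotentialRegularity

section LawOfLargeNumbers

open scoped ENNReal

variable {d : ℕ} {μ : (Fin d → ℤ) → ℝ} {ρ : ℝ}

lemma LightTailed.tsum_convPow_eq_one (hμ : LightTailed μ ρ) (n : ℕ) :
    ∑' z, convPow (fun z => ENNReal.ofReal (μ z)) n z = 1 := by
  rw [tsum_convPow, tsum_ofReal_eq_one hμ.nonneg hμ.hasSum, one_pow]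

/-- Large deviation bound for an additive functional of the walk. -/
lemma LightTailed.tendsto_tsum_convPow_deviation (hμ : LightTailed μ ρ) {L : (Fin d → ℤ) → ℝ}
    {c : ℝ} (h0 : L 0 = 0) (hadd : ∀ x y, L (x + y) = L x + L y) (hL : ∀ z, |L z| ≤ znorm z)
    (hc : ∑' z, μ z * L z < c) :
    Tendsto (fun n : ℕ => ∑' z, if c * n ≤ L z then
      convPow (fun z => ENNReal.ofReal (μ z)) n z else 0) atTop (𝓝 0) := by
  set m : (Fin d → ℤ) → ℝ≥0∞ := fun z => ENNReal.ofReal (μ z)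
  have hsumL : Summable fun z => μ z * L z :=
    summable_mul_of_linear_growth hμ.nonneg hμ.pos hμ.summable_exp one_pos
      (fun z => (hL z).trans (by linarith))
  obtain ⟨θ, hθ, h⟩ := exists_tsum_exp_lt_one_of_neg hμ.nonneg hμ.hasSum hμ.pos hμ.summable_exp
    (g := fun z => L z - c) (K := 1 + |c|) (by positivity)
    (fun z => by
      have hN := znorm_nonneg z
      refine (abs_sub _ _).trans ?_
      nlinarith [hL z, mul_nonneg (abs_nonneg c) hN]) (by
      simp_rw [mul_sub]
      rw [hsumL.tsum_sub (hμ.hasSum.summable.mul_right c), tsum_mul_right, hμ.hasSum.tsum_eq]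
      linarith)
  set r := ∑' z, ENNReal.ofReal (μ z) * ENNReal.ofReal (Real.exp (θ * (L z - c)))
  have hr : r = ENNReal.ofReal (Real.exp (-(θ * c)))
      * ∑' z, m z * ENNReal.ofReal (Real.exp (θ * L z)) := by
    rw [← ENNReal.tsum_mul_left]
    refine tsum_congr fun z => ?_
    rw [mul_left_comm, ← ENNReal.ofReal_mul (Real.exp_pos _).le, ← Real.exp_add]
    congr 3
    ring
  refine tendsto_of_tendsto_of_tendsto_of_le_of_le tendsto_const_nhds
    (ENNReal.tendsto_pow_atTop_nhds_zero_of_lt_one h) (fun _ => zero_le) fun n => ?_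
  change ∑' z, (if c * n ≤ L z then convPow m n z else 0) ≤ r ^ n
  rw [hr, mul_pow]
  refine le_trans ?_ (mul_le_mul_right (tsum_convPow_mul_le m
    (fun z => ENNReal.ofReal (Real.exp (θ * L z))) (by simp [h0]) (fun x y => ?_) n) _)
  · rw [← ENNReal.tsum_mul_left]
    refine ENNReal.tsum_le_tsum fun z => ?_
    split_ifs with hz
    · rw [mul_left_comm, ← ENNReal.ofReal_pow (Real.exp_pos _).le, ← Real.exp_nat_mul,
        ← ENNReal.ofReal_mul (Real.exp_pos _).le, ← Real.exp_add]
      refine le_mul_of_one_le_right' ?_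
      rw [ENNReal.one_le_ofReal]
      refine Real.one_le_exp ?_
      nlinarith
    · exact zero_le
  · rw [← ENNReal.ofReal_mul (Real.exp_pos _).le, ← Real.exp_add, hadd, mul_add]

/-- Weak law of large numbers. -/
lemma LightTailed.eventually_half_le_tsum_convPow (hμ : LightTailed μ ρ) {δ : ℝ} (hδ : 0 < δ) :
    ∀ᶠ n : ℕ in atTop, 2⁻¹ ≤ ∑' z : Fin d → ℤ, if ∀ i, |(z i : ℝ) - n * Mvec μ i| ≤ δ * n then
      convPow (fun z => ENNReal.ofReal (μ z)) n z else 0 := by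
  set m : (Fin d → ℤ) → ℝ≥0∞ := fun z => ENNReal.ofReal (μ z)
  have hdev : ∀ (i : Fin d) (a : ℝ), |a| = 1 →
      Tendsto (fun n : ℕ => ∑' z : Fin d → ℤ, if (a * Mvec μ i + δ) * n ≤ a * (z i : ℝ) then
        convPow m n z else 0) atTop (𝓝 0) := fun i a ha =>
    hμ.tendsto_tsum_convPow_deviation (by simp) (fun x y => by simp [mul_add])
      (fun z => by rw [abs_mul, ha, one_mul]; exact abs_apply_le_znorm z i)
      (by rw [tsum_mul_coord]; linarith)
  have hlim : Tendsto (fun n : ℕ => ∑ i : Fin d,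
      ((∑' z : Fin d → ℤ, if (1 * Mvec μ i + δ) * n ≤ 1 * (z i : ℝ) then convPow m n z else 0)
      + ∑' z : Fin d → ℤ, if (-1 * Mvec μ i + δ) * n ≤ -1 * (z i : ℝ) then convPow m n z else 0))
      atTop (𝓝 0) := by
    have := tendsto_finsetSum (Finset.univ : Finset (Fin d)) fun i _ =>
      (hdev i 1 (by simp)).add (hdev i (-1) (by simp))
    simpa using this
  have hhalf : (0 : ℝ≥0∞) < 2⁻¹ := by simp
  filter_upwards [hlim.eventually_lt_const hhalf] with n hn
  set good := ∑' z : Fin d → ℤ, if ∀ i, |(z i : ℝ) - n * Mvec μ i| ≤ δ * n then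
      convPow m n z else 0
  by_contra! hlt
  have hle : (1 : ℝ≥0∞) ≤ good + ∑ i : Fin d,
      ((∑' z : Fin d → ℤ, if (1 * Mvec μ i + δ) * n ≤ 1 * (z i : ℝ) then convPow m n z else 0)
      + ∑' z : Fin d → ℤ, if (-1 * Mvec μ i + δ) * n ≤ -1 * (z i : ℝ)
          then convPow m n z else 0) := by
    rw [← hμ.tsum_convPow_eq_one n]
    simp_rw [← ENNReal.tsum_add]
    rw [← Summable.tsum_finsetSum fun _ _ => ENNReal.summable, ← ENNReal.tsum_add]
    refine ENNReal.tsum_le_tsum fun z => ?_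
    by_cases hz : ∀ i, |(z i : ℝ) - n * Mvec μ i| ≤ δ * n
    · rw [if_pos hz]
      exact le_self_add
    · push Not at hz
      obtain ⟨i, hi⟩ := hz
      refine le_trans ?_ le_add_self
      refine le_trans ?_ (Finset.single_le_sum (fun _ _ => zero_le) (Finset.mem_univ i))
      rcases lt_abs.1 hi with h | h
      · rw [if_pos (by linarith)]
        exact le_self_add
      · rw [if_pos (c := (-1 * Mvec μ i + δ) * n ≤ -1 * (z i : ℝ)) (by linarith)]
        exact le_add_self
  refine absurd hle (not_le.2 ((ENNReal.add_lt_add hlt hn).trans_le ?_))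
  rw [ENNReal.inv_two_add_inv_two]

end LawOfLargeNumbers

section PotentialRatio

open scoped ENNReal

variable {d : ℕ} {μ : (Fin d → ℤ) → ℝ} {ρ : ℝ}

lemma LightTailed.ofReal_realPotential (hμ : LightTailed μ ρ) {i : Fin d} (hM : 0 < Mvec μ i)
    (y : Fin d → ℤ) :
    ENNReal.ofReal (realPotential μ y) = potential (fun z => ENNReal.ofReal (μ z)) y :=
  ENNReal.ofReal_toReal (hμ.potential_ne_top hM y)

lemma LightTailed.realPotential_pos (hμ : LightTailed μ ρ) (hA1 : A1 μ) {i : Fin d}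
    (hM : 0 < Mvec μ i) (y : Fin d → ℤ) : 0 < realPotential μ y := by
  obtain ⟨β, -, h⟩ := hμ.exists_exp_le_realPotential hA1 hM
  exact (Real.exp_pos _).trans_le (h y)

/-- Along a sequence escaping in the direction of the mean, the points are within sublinear
distance of the mean trajectory. -/
lemma tendsto_sum_abs_sub_floor_mul_div {xs : ℕ → Fin d → ℤ} {M : Fin d → ℝ} (hr : 0 < rnorm M)
    (hN : Tendsto (fun n => znorm (xs n)) atTop atTop)
    (hdir : Tendsto (fun n i => (xs n i : ℝ) / znorm (xs n)) atTop (𝓝 fun i => M i / rnorm M)) :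
    Tendsto (fun n => (∑ i, |(xs n i : ℝ) - ⌊(rnorm M)⁻¹ * znorm (xs n)⌋₊ * M i|) / znorm (xs n))
      atTop (𝓝 0) := by
  have hk := (tendsto_nat_floor_mul_div_atTop (inv_nonneg.2 hr.le)).comp hN
  have h : Tendsto (fun n => ∑ i, |(xs n i : ℝ) / znorm (xs n)
      - ((⌊(rnorm M)⁻¹ * znorm (xs n)⌋₊ : ℝ) / znorm (xs n)) * M i|) atTop
      (𝓝 (∑ i, |M i / rnorm M - (rnorm M)⁻¹ * M i|)) :=
    tendsto_finsetSum _ fun i _ => ((tendsto_pi_nhds.1 hdir i).sub (hk.mul_const (M i))).abs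
  have h0 : ∑ i, |M i / rnorm M - (rnorm M)⁻¹ * M i| = 0 :=
    Finset.sum_eq_zero fun i _ => by rw [div_eq_inv_mul, sub_self, abs_zero]
  rw [h0] at h
  refine h.congr' ?_
  filter_upwards [hN.eventually_gt_atTop 0] with n hn
  rw [Finset.sum_div]
  refine Finset.sum_congr rfl fun i _ => ?_
  rw [div_mul_eq_mul_div, ← sub_div, abs_div, abs_of_pos hn]

lemma LightTailed.eventually_exp_le_realPotential (hμ : LightTailed μ ρ) (hA1 : A1 μ) {i₀ : Fin d}
    (hM : 0 < Mvec μ i₀) {xs : ℕ → Fin d → ℤ}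
    (hN : Tendsto (fun n => znorm (xs n)) atTop atTop)
    (hdir : Tendsto (fun n i => (xs n i : ℝ) / znorm (xs n)) atTop
      (𝓝 fun i => Mvec μ i / rnorm (Mvec μ))) {κ : ℝ} (hκ : 0 < κ) :
    ∀ᶠ n in atTop, 2⁻¹ * Real.exp (-(κ * znorm (xs n))) ≤ realPotential μ (xs n) := by
  set m : (Fin d → ℤ) → ℝ≥0∞ := fun z => ENNReal.ofReal (μ z)
  obtain ⟨β, hβ, hlow⟩ := hμ.exists_exp_le_realPotential hA1 hM
  set r := rnorm (Mvec μ)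
  have hr : 0 < r :=
    (abs_pos_of_pos hM).trans_le
      (Finset.single_le_sum (f := fun i => |Mvec μ i|) (fun _ _ => abs_nonneg _)
        (Finset.mem_univ i₀))
  set ε := κ / (2 * (β + 1))
  have hε : 0 < ε := by positivity
  have hεβ : β * (2 * ε) ≤ κ := by
    rw [show (2 : ℝ) * ε = κ / (β + 1) by simp only [ε]; field_simp, mul_div_assoc',
      div_le_iff₀ (by positivity)]
    nlinarith
  set δ := ε * r / (d + 1)
  have hδ : 0 < δ := by positivity
  have hδd : d * δ ≤ ε * r := by
    simp only [δ]
    rw [mul_div_assoc', div_le_iff₀ (by positivity)]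
    nlinarith [mul_pos hε hr]
  have hk : Tendsto (fun n => ⌊r⁻¹ * znorm (xs n)⌋₊) atTop atTop :=
    tendsto_nat_floor_atTop.comp (hN.const_mul_atTop (inv_pos.2 hr))
  filter_upwards [hk.eventually (hμ.eventually_half_le_tsum_convPow hδ), hN.eventually_gt_atTop 0,
    (tendsto_sum_abs_sub_floor_mul_div hr hN hdir).eventually_lt_const hε] with n hn hpos hclose
  set k := ⌊r⁻¹ * znorm (xs n)⌋₊
  rw [div_lt_iff₀ hpos] at hclose
  have hkr : k * r ≤ znorm (xs n) := by
    rw [← le_div_iff₀ hr, div_eq_inv_mul]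
    exact Nat.floor_le (by positivity)
  have hdist : ∀ z : Fin d → ℤ, (∀ i, |(z i : ℝ) - k * Mvec μ i| ≤ δ * k) →
      znorm (xs n - z) ≤ 2 * ε * znorm (xs n) := by
    intro z hz
    calc znorm (xs n - z) ≤ ∑ i, (|(xs n i : ℝ) - k * Mvec μ i| + δ * k) := by
          refine Finset.sum_le_sum fun i _ => ?_
          rw [Pi.sub_apply, Int.cast_sub]
          refine (abs_sub_le _ (k * Mvec μ i) _).trans ?_
          rw [abs_sub_comm (k * Mvec μ i)]
          gcongr
          exact hz i
      _ = ∑ i, |(xs n i : ℝ) - k * Mvec μ i| + d * δ * k := by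
          rw [Finset.sum_add_distrib]; simp [mul_assoc]
      _ ≤ ε * znorm (xs n) + ε * r * k := by gcongr
      _ ≤ _ := by nlinarith
  rw [← ENNReal.ofReal_le_ofReal_iff (realPotential_nonneg _), hμ.ofReal_realPotential hM,
    ENNReal.ofReal_mul (by norm_num), ENNReal.ofReal_inv_of_pos two_pos, ENNReal.ofReal_ofNat]
  refine (mul_le_mul_left hn _).trans (le_trans ?_ (tsum_convPow_mul_potential_le m k (xs n)))
  rw [← ENNReal.tsum_mul_right]
  refine ENNReal.tsum_le_tsum fun z => ?_
  split_ifs with hz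
  · refine mul_le_mul_right ?_ _
    rw [← hμ.ofReal_realPotential hM]
    refine ENNReal.ofReal_le_ofReal (le_trans (Real.exp_le_exp.2 ?_) (hlow _))
    nlinarith [mul_le_mul_of_nonneg_left (hdist z hz) hβ]
  · simp

lemma LightTailed.tendsto_exp_div_realPotential (hμ : LightTailed μ ρ) (hA1 : A1 μ) {i₀ : Fin d}
    (hM : 0 < Mvec μ i₀) {xs : ℕ → Fin d → ℤ}
    (hN : Tendsto (fun n => znorm (xs n)) atTop atTop)
    (hdir : Tendsto (fun n i => (xs n i : ℝ) / znorm (xs n)) atTop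
      (𝓝 fun i => Mvec μ i / rnorm (Mvec μ))) {κ : ℝ} (hκ : 0 < κ) :
    Tendsto (fun n => Real.exp (-(κ * znorm (xs n))) / realPotential μ (xs n)) atTop (𝓝 0) := by
  have h2 : Tendsto (fun n => 2 * Real.exp (-(κ / 2 * znorm (xs n)))) atTop (𝓝 0) := by
    simpa using ((Real.tendsto_exp_neg_atTop_nhds_zero.comp
      (hN.const_mul_atTop (half_pos hκ))).const_mul 2)
  refine squeeze_zero' (Eventually.of_forall fun n =>
    div_nonneg (Real.exp_pos _).le (realPotential_nonneg _)) ?_ h2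
  filter_upwards [hμ.eventually_exp_le_realPotential hA1 hM hN hdir (half_pos hκ)] with n hn
  rw [div_le_iff₀ (hμ.realPotential_pos hA1 hM _)]
  calc Real.exp (-(κ * znorm (xs n)))
      = 2 * Real.exp (-(κ / 2 * znorm (xs n))) * (2⁻¹ * Real.exp (-(κ / 2 * znorm (xs n)))) := by
        rw [mul_mul_mul_comm, ← Real.exp_add]
        ring_nf
    _ ≤ _ := by gcongr

/-- Uniform bound and limit for the ratios of the potential kernel. -/
lemma LightTailed.exists_ratio_bounds (hμ : LightTailed μ ρ) (hA1 : A1 μ) {i₀ : Fin d}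
    (hM : 0 < Mvec μ i₀) {xs : ℕ → Fin d → ℤ}
    (hN : Tendsto (fun n => znorm (xs n)) atTop atTop)
    (hdir : Tendsto (fun n i => (xs n i : ℝ) / znorm (xs n)) atTop
      (𝓝 fun i => Mvec μ i / rnorm (Mvec μ))) {b : ℝ} (hb : 0 < b) :
    ∃ u v : ℕ → ℝ, Tendsto u atTop (𝓝 1) ∧ Tendsto v atTop (𝓝 0) ∧ ∃ κ > 0, ∀ n x,
      realPotential μ (xs n - x) / realPotential μ (xs n) ≤ Real.exp (b * znorm x) * u n ∧
      Real.exp (-(b * znorm x)) * u n - Real.exp (κ * znorm x) * v n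
        ≤ realPotential μ (xs n - x) / realPotential μ (xs n) := by
  obtain ⟨B, hB, κ, hκ, h⟩ := hμ.exists_corrected_potential hA1 hM hb
  have hv := (hμ.tendsto_exp_div_realPotential hA1 hM hN hdir hκ).const_mul B
  rw [mul_zero] at hv
  refine ⟨_, _, by simpa using hv.const_add 1, hv, κ, hκ, fun n x => ?_⟩
  have hp := hμ.realPotential_pos hA1 hM (xs n)
  set g := realPotential μ (xs n)
  have hu : 1 + B * (Real.exp (-(κ * znorm (xs n))) / g)
      = (g + B * Real.exp (-(κ * znorm (xs n)))) / g := by field_simp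
  have h1 := h (-x) (xs n)
  have h2 := h x (xs n - x)
  rw [znorm_neg, ← sub_eq_add_neg] at h1
  rw [sub_add_cancel] at h2
  rw [hu]
  constructor
  · rw [mul_div_assoc', div_le_div_iff_of_pos_right hp]
    have : 0 ≤ B * Real.exp (-(κ * znorm (xs n - x))) := by positivity
    linarith
  · rw [mul_div_assoc', mul_div_assoc', mul_div_assoc', ← sub_div, div_le_div_iff_of_pos_right hp]
    have h3 : Real.exp (-(κ * znorm (xs n - x)))
        ≤ Real.exp (κ * znorm x) * Real.exp (-(κ * znorm (xs n))) := by
      rw [← Real.exp_add]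
      have := znorm_add_le (xs n - x) x
      rw [sub_add_cancel] at this
      exact Real.exp_le_exp.2 (by nlinarith)
    have h4 := mul_le_mul_of_nonneg_left h2 (Real.exp_pos (-(b * znorm x))).le
    rw [← mul_assoc, ← Real.exp_add, neg_add_cancel, Real.exp_zero, one_mul] at h4
    nlinarith [mul_le_mul_of_nonneg_left h3 hB]

lemma LightTailed.eventually_realPotential_ratio_le (hμ : LightTailed μ ρ) (hA1 : A1 μ)
    {i₀ : Fin d} (hM : 0 < Mvec μ i₀) {xs : ℕ → Fin d → ℤ}
    (hN : Tendsto (fun n => znorm (xs n)) atTop atTop)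
    (hdir : Tendsto (fun n i => (xs n i : ℝ) / znorm (xs n)) atTop
      (𝓝 fun i => Mvec μ i / rnorm (Mvec μ))) {b : ℝ} (hb : 0 < b) :
    ∀ᶠ n in atTop, ∀ x, realPotential μ (xs n - x) / realPotential μ (xs n)
      ≤ 2 * Real.exp (b * znorm x) := by
  obtain ⟨u, v, hu, -, κ, -, h⟩ := hμ.exists_ratio_bounds hA1 hM hN hdir hb
  filter_upwards [hu.eventually_lt_const one_lt_two] with n hn x
  refine (h n x).1.trans ?_
  rw [mul_comm]
  gcongr

lemma LightTailed.tendsto_realPotential_ratio (hμ : LightTailed μ ρ) (hA1 : A1 μ)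
    {i₀ : Fin d} (hM : 0 < Mvec μ i₀) {xs : ℕ → Fin d → ℤ}
    (hN : Tendsto (fun n => znorm (xs n)) atTop atTop)
    (hdir : Tendsto (fun n i => (xs n i : ℝ) / znorm (xs n)) atTop
      (𝓝 fun i => Mvec μ i / rnorm (Mvec μ))) (x : Fin d → ℤ) :
    Tendsto (fun n => realPotential μ (xs n - x) / realPotential μ (xs n)) atTop (𝓝 1) := by
  have hb0 : ∀ c : ℝ, Tendsto (fun b => Real.exp (c * b)) (𝓝[>] 0) (𝓝 1) := fun c => by
    have : Continuous fun b => Real.exp (c * b) := by fun_prop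
    simpa using (this.tendsto 0).mono_left nhdsWithin_le_nhds
  refine tendsto_order.2 ⟨fun a ha => ?_, fun a ha => ?_⟩
  · obtain ⟨b, hab, hb⟩ := (((hb0 (-znorm x)).eventually_const_lt ha).and
      self_mem_nhdsWithin).exists
    obtain ⟨u, v, hu, hv, κ, -, h⟩ := hμ.exists_ratio_bounds hA1 hM hN hdir hb
    have hlim : Tendsto (fun n => Real.exp (-(b * znorm x)) * u n - Real.exp (κ * znorm x) * v n)
        atTop (𝓝 (Real.exp (-znorm x * b))) := by
      have := (hu.const_mul (Real.exp (-(b * znorm x)))).sub (hv.const_mul (Real.exp (κ * znorm x)))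
      convert this using 2
      ring_nf
    filter_upwards [hlim.eventually_const_lt hab] with n hn
    exact hn.trans_le (h n x).2
  · obtain ⟨b, hab, hb⟩ := (((hb0 (znorm x)).eventually_lt_const ha).and
      self_mem_nhdsWithin).exists
    obtain ⟨u, v, hu, hv, κ, -, h⟩ := hμ.exists_ratio_bounds hA1 hM hN hdir hb
    have hlim : Tendsto (fun n => Real.exp (b * znorm x) * u n)
        atTop (𝓝 (Real.exp (znorm x * b))) := by
      have := hu.const_mul (Real.exp (b * znorm x))
      convert this using 2
      ring_nf
    filter_upwards [hlim.eventually_lt_const hab] with n hn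
    exact (h n x).1.trans_lt hn

end PotentialRatio

section EscapeProbability

open scoped ENNReal

variable {d : ℕ} {μ : (Fin d → ℤ) → ℝ} {ρ : ℝ}

lemma LightTailed.exists_tsum_exitLaw_coord_le (hμ : LightTailed μ ρ) {i : Fin d}
    (hM : 0 < Mvec μ i) (A : Set (Fin d → ℤ)) : ∃ θ > 0, ∃ κ > 0, ∃ C : ℝ≥0∞, C < ⊤ ∧ ∀ x,
      ∑' z, (if z i ≤ 0 then exitLaw (fun z => ENNReal.ofReal (μ z)) A x z
        * ENNReal.ofReal (Real.exp (κ * znorm (z - x))) else 0)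
        ≤ C * ENNReal.ofReal (Real.exp (-(θ * x i))) := by
  obtain ⟨θ, hθ, κ, hκ, h⟩ := exists_tsum_exp_add_znorm_lt_one hμ.nonneg hμ.hasSum hμ.pos
    hμ.summable_exp (g := fun z => -1 * (z i : ℝ)) one_pos (fun z => by
      simpa using (abs_apply_le_znorm z i).trans (by linarith)) (by
      rw [tsum_mul_coord]; linarith)
  have hC := tsum_potential_mul_exp_lt_top (fun z => ENNReal.ofReal (μ z))
    (F := fun z => θ * (-1 * (z i : ℝ)) + κ * znorm z) (by simp [znorm_zero]) (fun x y => by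
      have := mul_le_mul_of_nonneg_left (znorm_add_le x y) hκ.le
      push_cast [Pi.add_apply]
      linarith) h
  refine ⟨θ, hθ, κ, hκ, _, hC, fun x => ?_⟩
  conv_rhs => rw [← tsum_sub_const _ x, ← ENNReal.tsum_mul_right]
  refine ENNReal.tsum_le_tsum fun z => ?_
  split_ifs with hz
  · rw [mul_assoc, ← ENNReal.ofReal_mul (Real.exp_pos _).le, ← Real.exp_add]
    refine mul_le_mul' (exitLaw_le_potential _ _ _ _)
      (ENNReal.ofReal_le_ofReal (Real.exp_le_exp.2 ?_))
    have hz' : (z i : ℝ) ≤ 0 := by exact_mod_cast hz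
    push_cast [Pi.sub_apply]
    nlinarith
  · exact zero_le

/-- Exponential moment of the exit point from the positive orthant. -/
lemma LightTailed.exists_tsum_exitLaw_le (hμ : LightTailed μ ρ) (hM : ∀ i, 0 < Mvec μ i) :
    ∃ κ > 0, ∃ (θ : Fin d → ℝ) (C : Fin d → ℝ≥0∞), (∀ i, 0 < θ i) ∧ (∀ i, C i < ⊤) ∧ ∀ x,
      ∑' z, exitLaw (fun z => ENNReal.ofReal (μ z)) posAll x z
        * ENNReal.ofReal (Real.exp (κ * znorm (z - x)))
        ≤ ∑ i, C i * ENNReal.ofReal (Real.exp (-(θ i * x i))) := by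
  choose θ hθ κ hκ C hC h using fun i => hμ.exists_tsum_exitLaw_coord_le (hM i) posAll
  obtain ⟨κ₀, hκ₀, hle⟩ : ∃ κ₀ > 0, ∀ i, κ₀ ≤ κ i := by
    rcases isEmpty_or_nonempty (Fin d) with hd | hd
    · exact ⟨1, one_pos, fun i => isEmptyElim i⟩
    · obtain ⟨j, hj⟩ := Finite.exists_min κ
      exact ⟨κ j, hκ j, hj⟩
  refine ⟨κ₀, hκ₀, θ, C, hθ, hC, fun x => ?_⟩
  refine le_trans ?_ (Finset.sum_le_sum fun i _ => h i x)
  rw [← Summable.tsum_finsetSum fun _ _ => ENNReal.summable]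
  refine ENNReal.tsum_le_tsum fun z => ?_
  by_cases hz : z ∈ posAll
  · rw [exitLaw_of_mem _ hz, zero_mul]
    exact zero_le
  · obtain ⟨i, hi⟩ : ∃ i, z i ≤ 0 := by simpa [posAll] using hz
    refine le_trans ?_ (Finset.single_le_sum (fun _ _ => zero_le) (Finset.mem_univ i))
    rw [if_pos hi]
    gcongr
    · exact znorm_nonneg _
    · exact hle i

lemma survP_eq (hnn : ∀ z, 0 ≤ μ z) (hsum : HasSum μ 1) (x : Fin d → ℤ) :
    survP μ x = 1 - (∑' z, exitLaw (fun z => ENNReal.ofReal (μ z)) posAll x z).toReal := by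
  rw [survP, exitExp_one_eq_toReal hnn hsum]

lemma tsum_exitLaw_ofReal_le_one (hnn : ∀ z, 0 ≤ μ z) (hsum : HasSum μ 1)
    (A : Set (Fin d → ℤ)) (x : Fin d → ℤ) :
    ∑' z, exitLaw (fun z => ENNReal.ofReal (μ z)) A x z ≤ 1 :=
  tsum_exitLaw_le_one _ (tsum_ofReal_eq_one hnn hsum).le _ _

lemma survP_nonneg (hnn : ∀ z, 0 ≤ μ z) (hsum : HasSum μ 1) (x : Fin d → ℤ) : 0 ≤ survP μ x := by
  rw [survP_eq hnn hsum, sub_nonneg]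
  exact ENNReal.toReal_le_of_le_ofReal zero_le_one (by
    simpa using tsum_exitLaw_ofReal_le_one hnn hsum posAll x)

lemma hasSum_survP (hnn : ∀ z, 0 ≤ μ z) (hsum : HasSum μ 1) {x : Fin d → ℤ} (hx : x ∈ posAll) :
    HasSum (fun y => if y ∈ posAll then μ (y - x) * survP μ y else 0) (survP μ x) := by
  set e : (Fin d → ℤ) → ℝ≥0∞ := fun x => ∑' z, exitLaw (fun z => ENNReal.ofReal (μ z)) posAll x z
  have he : ∀ x, e x ≤ 1 := tsum_exitLaw_ofReal_le_one hnn hsum posAll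
  have hexit : e x = ∑' v, ENNReal.ofReal (μ (v - x)) * (if v ∈ posAll then e v else 1) :=
    tsum_exitLaw_eq _ hx
  have hne : ∑' v, ENNReal.ofReal (μ (v - x)) * (if v ∈ posAll then e v else 1) ≠ ⊤ :=
    hexit ▸ ((he x).trans_lt ENNReal.one_lt_top).ne
  have h1 := ENNReal.hasSum_toReal hne
  rw [← ENNReal.tsum_toReal_eq (ENNReal.ne_top_of_tsum_ne_top hne), ← hexit] at h1
  have h2 : HasSum (fun v => μ (v - x)) 1 := (Equiv.subRight x).hasSum_iff.2 hsum
  have hsub := h2.sub h1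
  rw [← survP_eq hnn hsum x] at hsub
  suffices h : ∀ v, (if v ∈ posAll then μ (v - x) * survP μ v else 0) = μ (v - x)
      - (ENNReal.ofReal (μ (v - x)) * (if v ∈ posAll then e v else 1)).toReal by
    rw [funext h]
    exact hsub
  intro v
  rw [ENNReal.toReal_mul, ENNReal.toReal_ofReal (hnn _)]
  split_ifs with hv
  · rw [survP_eq hnn hsum]
    ring
  · simp

lemma mul_survP_le (hnn : ∀ z, 0 ≤ μ z) (hsum : HasSum μ 1) {x y : Fin d → ℤ} (hx : x ∈ posAll)
    (hy : y ∈ posAll) : μ (y - x) * survP μ y ≤ survP μ x := by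
  have := le_hasSum (hasSum_survP hnn hsum hx) y fun z _ => by
    split_ifs
    exacts [mul_nonneg (hnn _) (survP_nonneg hnn hsum z), le_rfl]
  rwa [if_pos hy] at this

lemma LightTailed.exists_survP_pos (hμ : LightTailed μ ρ) (hM : ∀ i, 0 < Mvec μ i) :
    ∃ x ∈ posAll, 0 < survP μ x := by
  obtain ⟨κ, hκ, θ, C, hθ, hC, h⟩ := hμ.exists_tsum_exitLaw_le hM
  have hlim : Tendsto (fun n : ℕ => ∑ i, C i * ENNReal.ofReal (Real.exp (-(θ i * (n : ℝ)))))
      atTop (𝓝 0) := by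
    have hi : ∀ i, Tendsto (fun n : ℕ => C i * ENNReal.ofReal (Real.exp (-(θ i * (n : ℝ)))))
        atTop (𝓝 0) := fun i => by
      have := ENNReal.Tendsto.const_mul (ENNReal.tendsto_ofReal
        (Real.tendsto_exp_neg_atTop_nhds_zero.comp
          (tendsto_natCast_atTop_atTop.const_mul_atTop (hθ i)))) (Or.inr (hC i).ne)
      simpa using this
    simpa using tendsto_finsetSum Finset.univ fun i _ => hi i
  obtain ⟨n, hn, hn0⟩ := ((hlim.eventually_lt_const zero_lt_one).and
    (eventually_gt_atTop 0)).exists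
  refine ⟨fun _ => n, fun _ => Int.natCast_pos.2 hn0, ?_⟩
  rw [survP_eq hμ.nonneg hμ.hasSum, sub_pos, ← ENNReal.toReal_one]
  refine ENNReal.toReal_strict_mono ENNReal.one_ne_top (lt_of_le_of_lt ?_ hn)
  refine le_trans ?_ ((h fun _ => n).trans (by simp))
  refine ENNReal.tsum_le_tsum fun z => le_mul_of_one_le_right' ?_
  rw [ENNReal.one_le_ofReal]
  exact Real.one_le_exp (mul_nonneg hκ.le (znorm_nonneg _))

lemma LightTailed.survP_pos (hμ : LightTailed μ ρ) (hA1 : A1 μ) (hM : ∀ i, 0 < Mvec μ i)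
    {x : Fin d → ℤ} (hx : x ∈ posAll) : 0 < survP μ x := by
  obtain ⟨x', hx', hpos⟩ := hμ.exists_survP_pos hM
  obtain ⟨k, c, rfl, rfl, hc, hstep⟩ := hA1 Set.univ x (fun i _ => hx i) x' fun i _ => hx' i
  have hc' : ∀ j ≤ k, c j ∈ posAll := fun j hj i => hc j hj i (Set.mem_univ i)
  refine Nat.decreasingInduction' (P := fun j => 0 < survP μ (c j)) (fun j hj _ ih => ?_)
    (Nat.zero_le k) hpos
  exact (mul_pos (hstep j hj) ih).trans_le
    (mul_survP_le hμ.nonneg hμ.hasSum (hc' j hj.le) (hc' (j + 1) hj))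

lemma LightTailed.green_eq_sub (hμ : LightTailed μ ρ) {i : Fin d} (hM : 0 < Mvec μ i)
    {A : Set (Fin d → ℤ)} {x : Fin d → ℤ} (hx : x ∈ A) (y : Fin d → ℤ) :
    green μ A x y = realPotential μ (y - x)
      - ∑' z, (exitLaw (fun z => ENNReal.ofReal (μ z)) A x z).toReal * realPotential μ (y - z) := by
  have h := potential_sub_eq (fun z => ENNReal.ofReal (μ z)) hx y
  have hne := hμ.potential_ne_top hM (y - x)
  rw [h, ENNReal.add_ne_top] at hne
  rw [green_eq_toReal hμ.nonneg hμ.hasSum, realPotential, h, ENNReal.toReal_add hne.1 hne.2,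
    ENNReal.tsum_toReal_eq fun z => ENNReal.ne_top_of_tsum_ne_top hne.2 z]
  simp only [ENNReal.toReal_mul, realPotential, add_sub_cancel_right]

/-- Asymptotics of the Green function along the direction of the mean. -/
lemma LightTailed.tendsto_green_div_realPotential (hμ : LightTailed μ ρ) (hA1 : A1 μ)
    (hM : ∀ i, 0 < Mvec μ i) (i₀ : Fin d) {xs : ℕ → Fin d → ℤ}
    (hN : Tendsto (fun n => znorm (xs n)) atTop atTop)
    (hdir : Tendsto (fun n i => (xs n i : ℝ) / znorm (xs n)) atTop
      (𝓝 fun i => Mvec μ i / rnorm (Mvec μ))) {x : Fin d → ℤ} (hx : x ∈ posAll) :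
    Tendsto (fun n => green μ posAll x (xs n) / realPotential μ (xs n)) atTop
      (𝓝 (survP μ x)) := by
  obtain ⟨κ, hκ, θ, C, hθ, hC, h⟩ := hμ.exists_tsum_exitLaw_le hM
  set q : (Fin d → ℤ) → ℝ≥0∞ := fun z => exitLaw (fun z => ENNReal.ofReal (μ z)) posAll x z
  have hq1 : ∑' z, q z ≤ 1 := tsum_exitLaw_ofReal_le_one hμ.nonneg hμ.hasSum posAll x
  have hqne : ∀ z, q z ≠ ⊤ :=
    ENNReal.ne_top_of_tsum_ne_top (hq1.trans_lt ENNReal.one_lt_top).ne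
  have hfin : ∑' z, q z * ENNReal.ofReal (Real.exp (κ * znorm (z - x))) ≠ ⊤ :=
    ((h x).trans_lt (ENNReal.sum_lt_top.2 fun i _ =>
      ENNReal.mul_lt_top (hC i) ENNReal.ofReal_lt_top)).ne
  have hmom : Summable fun z => (q z).toReal * (2 * Real.exp (κ * znorm z)) := by
    refine Summable.of_nonneg_of_le (fun z => by positivity) (fun z => ?_)
      ((ENNReal.summable_toReal hfin).mul_left (2 * Real.exp (κ * znorm x)))
    rw [ENNReal.toReal_mul, ENNReal.toReal_ofReal (Real.exp_pos _).le]
    have hexp : Real.exp (κ * znorm z)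
        ≤ Real.exp (κ * znorm x) * Real.exp (κ * znorm (z - x)) := by
      rw [← Real.exp_add, ← mul_add]
      have := znorm_add_le (z - x) x
      rw [sub_add_cancel] at this
      exact Real.exp_le_exp.2 (mul_le_mul_of_nonneg_left (by linarith) hκ.le)
    calc _ ≤ (q z).toReal * (2 * (Real.exp (κ * znorm x) * Real.exp (κ * znorm (z - x)))) := by
          gcongr
      _ = _ := by ring
  have hsum : Tendsto (fun n => ∑' z, (q z).toReal
      * (realPotential μ (xs n - z) / realPotential μ (xs n))) atTop
      (𝓝 (∑' z, (q z).toReal * 1)) := by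
    refine tendsto_tsum_of_dominated_convergence hmom
      (fun z => (hμ.tendsto_realPotential_ratio hA1 (hM i₀) hN hdir z).const_mul _) ?_
    filter_upwards [hμ.eventually_realPotential_ratio_le hA1 (hM i₀) hN hdir hκ] with n hn z
    rw [Real.norm_of_nonneg (mul_nonneg ENNReal.toReal_nonneg
      (div_nonneg (realPotential_nonneg _) (realPotential_nonneg _)))]
    exact mul_le_mul_of_nonneg_left (hn z) ENNReal.toReal_nonneg
  have hlim := (hμ.tendsto_realPotential_ratio hA1 (hM i₀) hN hdir x).sub hsum
  rw [survP_eq hμ.nonneg hμ.hasSum, ENNReal.tsum_toReal_eq hqne]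
  simp only [mul_one] at hlim
  refine hlim.congr fun n => ?_
  rw [hμ.green_eq_sub (hM i₀) hx, sub_div, ← tsum_div_const]
  simp only [mul_div_assoc, q]

end EscapeProbability

theorem statement1 {d : ℕ} (μ : (Fin d → ℤ) → ℝ)
    (hnn : ∀ z, 0 ≤ μ z) (hsum : HasSum μ 1)
    (hA1 : A1 μ) (hA2 : A2 μ) (hA3 : A3 μ)
    (hM : ∀ i, 0 < Mvec μ i) (x₀ : Fin d → ℤ) (hx₀ : x₀ ∈ posAll) :
    -- (i)
    ((∀ x ∈ posAll, 0 < survP μ x) ∧ HarmOn μ posAll (survP μ)) ∧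
    -- (ii)
    (∀ xs : ℕ → (Fin d → ℤ), (∀ n, xs n ∈ posAll) →
      Tendsto (fun n => znorm (xs n)) atTop atTop →
      Tendsto (fun n i => (xs n i : ℝ) / znorm (xs n)) atTop
        (𝓝 (fun i => Mvec μ i / rnorm (Mvec μ))) →
      Fundamental μ posAll x₀ xs ∧
      ∀ x ∈ posAll,
        Tendsto (fun n => green μ posAll x (xs n) / green μ posAll x₀ (xs n)) atTop
          (𝓝 (survP μ x / survP μ x₀))) := by
  obtain ⟨ρ, hρ, hexp⟩ := exists_summable_exp_znorm hnn hsum hA2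
  have hμ : LightTailed μ ρ := ⟨hnn, hsum, hρ, hexp⟩
  obtain ⟨i₀, -⟩ := Function.ne_iff.1 hA3
  refine ⟨⟨fun x hx => hμ.survP_pos hA1 hM hx, fun x hx => ?_⟩, fun xs _ hN hdir => ?_⟩
  · rw [← (hasSum_survP hnn hsum hx).tsum_eq]
  have hlim : ∀ x ∈ posAll,
      Tendsto (fun n => green μ posAll x (xs n) / green μ posAll x₀ (xs n)) atTop
        (𝓝 (survP μ x / survP μ x₀)) := by
    intro x hx
    refine ((hμ.tendsto_green_div_realPotential hA1 hM i₀ hN hdir hx).div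
      (hμ.tendsto_green_div_realPotential hA1 hM i₀ hN hdir hx₀)
      (hμ.survP_pos hA1 hM hx₀).ne').congr fun n => ?_
    exact div_div_div_cancel_right₀ (hμ.realPotential_pos hA1 (hM i₀) _).ne' _ _
  exact ⟨fun x hx => ⟨_, hlim x hx⟩, hlim⟩
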